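/- arXiv:2011.00151 — 2 statements merged into one kernel-verified Lean document; each statement's English description precedes it below -/
import Mathlib

section
/- Let r ≥ 6 and let E be a spanning subset of F_2^r \ {0} that is triangle-free and I_5-free with |E| = 2^(⌊r/2⌋ - 1) + 2^(⌈r/2⌉ - 1). Then there is a direct sum decomposition V = V_1 ⊕ V_2 with dim V_1 = ⌊r/2⌋ and dim V_2 = ⌈r/2⌉ such that E = A_1 ∪ A_2, where each A_i ⊆ V_i \ {0} is the complement of a hyperplane of V_i (an affine geometry of dimension dim V_i). -/
open Submodule

abbrev V2 (r : ℕ) := Fin r → ZMod 2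

def TriangleFree {r : ℕ} (E : Set (V2 r)) : Prop :=
  ∀ a ∈ E, ∀ b ∈ E, a + b ∉ E

/-- `E` has no induced `I_n`: no `n`-dimensional subspace `W` such that `E ∩ W` is a
basis of `W`. -/
def IFree {r : ℕ} (n : ℕ) (E : Set (V2 r)) : Prop :=
  ¬ ∃ S : Finset (V2 r), S.card = n ∧
      LinearIndependent (ZMod 2) (Subtype.val : ↥(S : Set (V2 r)) → V2 r) ∧
      E ∩ (span (ZMod 2) (S : Set (V2 r)) : Set (V2 r)) = (S : Set (V2 r))

section Binary

variable {V : Type*} [AddCommGroup V] [Module (ZMod 2) V]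

theorem mem_sup_span_singleton_iff {U : Submodule (ZMod 2) V} {g x : V} :
    x ∈ U ⊔ span (ZMod 2) {g} ↔ x ∈ U ∨ x + g ∈ U := by
  constructor
  · intro h
    obtain ⟨u, hu, v, hv, rfl⟩ := mem_sup.1 h
    obtain ⟨t, rfl⟩ := mem_span_singleton.1 hv
    obtain rfl | rfl : t = 0 ∨ t = 1 := by
      clear * -; revert t; decide
    · left; simpa using hu
    · right; simpa [add_assoc, ZModModule.add_self] using hu
  · have hg : g ∈ U ⊔ span (ZMod 2) {g} := mem_sup_right (mem_span_singleton_self g)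
    rintro (h | h)
    · exact mem_sup_left h
    · simpa [add_assoc, ZModModule.add_self] using add_mem (mem_sup_left h) hg

/-- `E ∩ U` is an `n`-element basis of the subspace `U`. -/
def IndFlat (E : Set V) (n : ℕ) (U : Submodule (ZMod 2) V) : Prop :=
  ∃ v : Fin n → V, LinearIndependent (ZMod 2) v ∧ span (ZMod 2) (Set.range v) = U ∧
    E ∩ U = Set.range v

theorem IndFlat.zero {E : Set V} (h0 : (0 : V) ∉ E) : IndFlat E 0 ⊥ :=
  ⟨![], linearIndependent_empty_type, by simp, by simpa using h0⟩

theorem IndFlat.insert {E : Set V} {n : ℕ} {U : Submodule (ZMod 2) V} (hU : IndFlat E n U)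
    {g : V} (hg : g ∈ E) (hgU : g ∉ U) (h : ∀ u ∈ U, g + u ∈ E → u = 0) :
    IndFlat E (n + 1) (U ⊔ span (ZMod 2) {g}) := by
  obtain ⟨v, hv, hspan, hE⟩ := hU
  refine ⟨Fin.cons g v, linearIndependent_finCons.2 ⟨hv, hspan ▸ hgU⟩, ?_, ?_⟩
  · rw [Fin.range_cons, span_insert, sup_comm, hspan]
  · rw [Fin.range_cons, ← hE]
    ext x
    simp only [Set.mem_inter_iff, SetLike.mem_coe, mem_sup_span_singleton_iff, Set.mem_insert_iff]
    constructor
    · rintro ⟨hx, hxU | hxU⟩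
      · exact Or.inr ⟨hx, hxU⟩
      · left
        have : x + g = 0 := h _ hxU (by
          convert hx using 1; grind [ZModModule.add_self g])
        grind [ZModModule.add_self g]
    · rintro (rfl | ⟨hx, hxU⟩)
      · exact ⟨hg, Or.inr (by simp [ZModModule.add_self])⟩
      · exact ⟨hx, Or.inl hxU⟩

theorem IndFlat.insert_outside {E : Set V} {n : ℕ} {U W : Submodule (ZMod 2) V}
    (hU : IndFlat E n U) (hUW : U ≤ W) {c : V} (hc : c ∈ E) (hcW : c ∉ W)
    (h : ∀ u ∈ U, c + u ∈ E → u = 0) : IndFlat E (n + 1) (U ⊔ span (ZMod 2) {c}) :=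
  hU.insert hc (fun h => hcW (hUW h)) h

theorem IndFlat.insert_outside_two {E : Set V} {n : ℕ} {U W : Submodule (ZMod 2) V}
    (hU : IndFlat E n U) (hUW : U ≤ W) {c d : V} (hc : c ∈ E) (hcW : c ∉ W)
    (hd : d ∈ E) (hdW : d ∉ W) (hcdW : c + d ∉ W)
    (hcd : ∀ w ∈ W, c + d + w ∉ E)
    (h : ∀ u ∈ U, c + u ∈ E → u = 0) (h' : ∀ u ∈ U, d + u ∈ E → u = 0) :
    IndFlat E (n + 2) (U ⊔ span (ZMod 2) {c} ⊔ span (ZMod 2) {d}) := by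
  refine (hU.insert_outside hUW hc hcW h).insert hd ?_ ?_
  · rw [mem_sup_span_singleton_iff]
    rintro (h | h)
    · exact hdW (hUW h)
    · exact hcdW (by simpa [add_comm] using hUW h)
  · intro u hu hE
    rw [mem_sup_span_singleton_iff] at hu
    rcases hu with hu | hu
    · exact h' u hu hE
    · refine absurd ?_ (hcd _ (hUW hu))
      convert hE using 1; grind [ZModModule.add_self c]

theorem IndFlat.insert_outside_three {E : Set V} {n : ℕ} {U W : Submodule (ZMod 2) V}
    (hU : IndFlat E n U) (hUW : U ≤ W) {c d e : V} (hc : c ∈ E) (hcW : c ∉ W)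
    (hd : d ∈ E) (hdW : d ∉ W) (he : e ∈ E) (heW : e ∉ W)
    (hcdW : c + d ∉ W) (hceW : c + e ∉ W) (hdeW : d + e ∉ W) (hcdeW : c + d + e ∉ W)
    (hcd : ∀ w ∈ W, c + d + w ∉ E) (hce : ∀ w ∈ W, c + e + w ∉ E) (hde : ∀ w ∈ W, d + e + w ∉ E)
    (hcde : ∀ w ∈ W, c + d + e + w ∉ E)
    (h : ∀ u ∈ U, c + u ∈ E → u = 0) (h' : ∀ u ∈ U, d + u ∈ E → u = 0)
    (h'' : ∀ u ∈ U, e + u ∈ E → u = 0) :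
    IndFlat E (n + 3) (U ⊔ span (ZMod 2) {c} ⊔ span (ZMod 2) {d} ⊔ span (ZMod 2) {e}) := by
  refine (hU.insert_outside_two hUW hc hcW hd hdW hcdW hcd h h').insert he ?_ ?_
  · simp only [mem_sup_span_singleton_iff]
    rintro ((h | h) | (h | h))
    · exact heW (hUW h)
    · exact hceW (by simpa [add_comm] using hUW h)
    · exact hdeW (by simpa [add_comm] using hUW h)
    · exact hcdeW (by convert hUW h using 1; abel)
  · intro u hu hE
    simp only [mem_sup_span_singleton_iff] at hu
    rcases hu with (hu | hu) | (hu | hu)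
    · exact h'' u hu hE
    · refine absurd ?_ (hce _ (hUW hu))
      convert hE using 1; grind [ZModModule.add_self c]
    · refine absurd ?_ (hde _ (hUW hu))
      convert hE using 1; grind [ZModModule.add_self d]
    · refine absurd ?_ (hcde _ (hUW hu))
      convert hE using 1; grind [ZModModule.add_self c, ZModModule.add_self d]

theorem mem_bot_sup_span_pair {p q u : V} :
    u ∈ (⊥ : Submodule (ZMod 2) V) ⊔ span (ZMod 2) {p} ⊔ span (ZMod 2) {q} ↔
      u = 0 ∨ u = p ∨ u = q ∨ u = p + q := by
  have hp := ZModModule.add_self p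
  have hq := ZModModule.add_self q
  simp only [mem_sup_span_singleton_iff, mem_bot]
  grind

theorem IndFlat.pair {E : Set V} (h0 : (0 : V) ∉ E) (hTF : ∀ a ∈ E, ∀ b ∈ E, a + b ∉ E)
    {p q : V} (hp : p ∈ E) (hq : q ∈ E) (hpq : p ≠ q) :
    IndFlat E 2 (⊥ ⊔ span (ZMod 2) {p} ⊔ span (ZMod 2) {q}) := by
  have hp0 : p ≠ 0 := fun h => h0 (h ▸ hp)
  have hq0 : q ≠ 0 := fun h => h0 (h ▸ hq)
  have hqq := ZModModule.add_self q
  have hpp := ZModModule.add_self p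
  refine ((IndFlat.zero h0).insert hp (by simpa using hp0) (by simp +contextual)).insert hq ?_ ?_
  · simp only [mem_sup_span_singleton_iff, mem_bot]
    grind
  · intro u hu hE
    simp only [mem_sup_span_singleton_iff, mem_bot] at hu
    rcases hu with hu | hu
    · exact hu
    · obtain rfl : u = p := by grind
      exact absurd hE (hTF _ hq _ hp)

/-- Given a covering of the differences of a spanning set by three subspaces, one of the pairwise
sums of the subspaces is large. -/
theorem exists_add_notMem_of_finrank [Finite V] {A : Set V} {W X Y Z : Submodule (ZMod 2) V}
    (hA : span (ZMod 2) A = W) (j : ℕ) (hW : Module.finrank (ZMod 2) W = 2 * j + 2)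
    (hX : Module.finrank (ZMod 2) X ≤ j) (hY : Module.finrank (ZMod 2) Y ≤ j)
    (hZ : Module.finrank (ZMod 2) Z ≤ j) :
    ∃ p ∈ A, ∃ q ∈ A, p + q ∉ X ∧ p + q ∉ Y ∧ p + q ∉ Z := by
  have key : ∀ (p : V) (X Y : Submodule (ZMod 2) V), Module.finrank (ZMod 2) X ≤ j →
      Module.finrank (ZMod 2) Y ≤ j → ∃ q ∈ A, p + q ∉ X ⊔ Y := by
    intro p X Y hX hY
    by_contra! hcon
    have hle : W ≤ X ⊔ Y ⊔ span (ZMod 2) {p} := by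
      rw [← hA, span_le]
      intro q hq
      exact mem_sup_span_singleton_iff.2 (Or.inr (by simpa [add_comm] using hcon q hq))
    have h1 := finrank_mono hle
    have h2 := finrank_add_le_finrank_add_finrank (X ⊔ Y) (span (ZMod 2) {p})
    have h3 := finrank_add_le_finrank_add_finrank X Y
    have h4 := finrank_span_le_card (R := ZMod 2) ({p} : Set V)
    simp at h4
    omega
  obtain ⟨p, hp⟩ : A.Nonempty := by
    obtain ⟨q, hq, -⟩ := key 0 X Y hX hY
    exact ⟨q, hq⟩
  obtain ⟨q, hq, hqXY⟩ := key p X Y hX hY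
  obtain ⟨s, hs, hsYZ⟩ := key p Y Z hY hZ
  by_contra! hcon
  have hqX : p + q ∉ X := fun h => hqXY (mem_sup_left h)
  have hqZ := hcon p hp q hq hqX (fun h => hqXY (mem_sup_right h))
  have hsX : p + s ∈ X := by
    by_contra h
    exact hsYZ (mem_sup_right (hcon p hp s hs h (fun h => hsYZ (mem_sup_left h))))
  have hsum : q + s = (p + q) + (p + s) := by grind [ZModModule.add_self p]
  have hqsX : q + s ∉ X := fun h => hqX ((X.add_mem_iff_left hsX).1 (hsum ▸ h))
  by_cases hqsY : q + s ∈ Y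
  · refine hqXY ?_
    convert add_mem (mem_sup_left (T := Y) hsX) (mem_sup_right (S := X) hqsY) using 1
    grind [ZModModule.add_self s]
  · have := hcon q hq s hs hqsX hqsY
    exact hsYZ (mem_sup_right ((Z.add_mem_iff_right hqZ).1 (hsum ▸ this)))

/-- A triangle-free set of nonzero vectors with no five-element independent flat. -/
structure Admissible (E : Set V) : Prop where
  zero_notMem : (0 : V) ∉ E
  add_notMem : ∀ a ∈ E, ∀ b ∈ E, a + b ∉ E
  not_indFlat : ∀ U : Submodule (ZMod 2) V, ¬ IndFlat E 5 U

/-- The part of `E` in the coset `c + W`. -/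
def fib (E : Set V) (W : Submodule (ZMod 2) V) (c : V) : Set V := {x | x ∈ E ∧ x + c ∈ W}

theorem fib_eq_of_add_mem {E : Set V} {W : Submodule (ZMod 2) V} {c d : V} (h : c + d ∈ W) :
    fib E W c = fib E W d := by
  ext x
  refine and_congr_right fun _ => ?_
  rw [← W.add_mem_iff_left h (x := x + d)]
  have : x + d + (c + d) = x + c := by grind [ZModModule.add_self d]
  rw [this]

theorem mem_fib_self {E : Set V} {W : Submodule (ZMod 2) V} {c : V} (hc : c ∈ E) :
    c ∈ fib E W c := ⟨hc, by simp [ZModModule.add_self]⟩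

theorem notMem_of_fib_eq_empty {E : Set V} {W : Submodule (ZMod 2) V} {c : V}
    (h : fib E W c = ∅) : ∀ w ∈ W, c + w ∉ E := fun w hw hE =>
  Set.eq_empty_iff_forall_notMem.1 h (c + w) ⟨hE, by
    convert hw using 1; grind [ZModModule.add_self c]⟩

theorem disjoint_fib {E : Set V} {W : Submodule (ZMod 2) V} {c d : V} (h : c + d ∉ W) :
    Disjoint (fib E W c) (fib E W d) := by
  rw [Set.disjoint_left]
  rintro x ⟨-, hx⟩ ⟨-, hx'⟩
  refine h ?_
  convert W.add_mem hx hx' using 1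
  grind [ZModModule.add_self x]

theorem card_submodule [Finite V] (W : Submodule (ZMod 2) V) :
    (W : Set V).ncard = 2 ^ Module.finrank (ZMod 2) W := by
  have := Module.natCard_eq_pow_finrank (K := ZMod 2) (V := W)
  rw [Nat.card_zmod] at this
  rw [← this]
  rfl

theorem exists_submodule_of_card_fib_lt [Finite V] {E : Set V} {W : Submodule (ZMod 2) V} {c : V}
    {j : ℕ} (hne : (fib E W c).Nonempty) (hlt : (fib E W c).ncard < 2 ^ (j + 1)) :
    ∃ X : Submodule (ZMod 2) V, Module.finrank (ZMod 2) X ≤ j ∧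
      ∀ w ∈ W, w ∉ X → ∃ x ∈ fib E W c, x + w ∉ E := by
  let X : Submodule (ZMod 2) V :=
    { carrier := {w | w ∈ W ∧ ∀ x ∈ fib E W c, x + w ∈ E}
      zero_mem' := ⟨W.zero_mem, fun x hx => by simpa using hx.1⟩
      add_mem' := by
        rintro a b ⟨ha, ha'⟩ ⟨hb, hb'⟩
        refine ⟨W.add_mem ha hb, fun x hx => ?_⟩
        rw [← add_assoc]
        refine hb' _ ⟨ha' x hx, ?_⟩
        convert W.add_mem hx.2 ha using 1
        abel
      smul_mem' := by
        rintro t a ⟨ha, ha'⟩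
        obtain rfl | rfl : t = 0 ∨ t = 1 := by
          clear * -; revert t; decide
        · exact ⟨by simp, fun x hx => by simpa using hx.1⟩
        · exact ⟨by simpa using ha, fun x hx => by simpa using ha' x hx⟩ }
  refine ⟨X, ?_, fun w hw hwX => ?_⟩
  · obtain ⟨x, hx⟩ := hne
    have hle : (X : Set V).ncard ≤ (fib E W c).ncard := by
      refine Set.ncard_le_ncard_of_injOn (fun w => x + w) ?_ ?_ (Set.toFinite _)
      · rintro w ⟨hw, hw'⟩
        refine ⟨hw' x hx, ?_⟩
        convert W.add_mem hx.2 hw using 1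
        abel
      · intro a _ b _ hab
        exact add_left_cancel hab
    rw [card_submodule] at hle
    have := (Nat.pow_lt_pow_iff_right (by norm_num)).1 (hle.trans_lt hlt)
    omega
  · by_contra! hcon
    exact hwX ⟨hw, hcon⟩

/-- Three cosets of `W` meeting `E` that form a three-element independent flat in the quotient. -/
structure Claw (E : Set V) (W : Submodule (ZMod 2) V) (c d e : V) : Prop where
  left : c ∉ W ∧ (fib E W c).Nonempty
  middle : d ∉ W ∧ (fib E W d).Nonempty
  right : e ∉ W ∧ (fib E W e).Nonempty
  left_middle : c + d ∉ W ∧ fib E W (c + d) = ∅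
  left_right : c + e ∉ W ∧ fib E W (c + e) = ∅
  middle_right : d + e ∉ W ∧ fib E W (d + e) = ∅
  sum : c + d + e ∉ W ∧ fib E W (c + d + e) = ∅

/-- A `2 * (j + 1)`-dimensional subspace spanned by `E` all of whose cosets that meet `E` contain
many elements of `E`. -/
structure Rich (E : Set V) (W : Submodule (ZMod 2) V) (j : ℕ) : Prop where
  finrank_eq : Module.finrank (ZMod 2) W = 2 * j + 2
  span_eq : span (ZMod 2) (E ∩ W) = W
  le_ncard : 2 ^ (j + 1) ≤ (E ∩ W).ncard
  le_ncard_fib : ∀ c, c ∉ W → (fib E W c).Nonempty → 2 ^ j ≤ (fib E W c).ncard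

theorem Claw.replace {E : Set V} {W : Submodule (ZMod 2) V} {c d e c' d' e' : V}
    (h : Claw E W c d e) (hc : c' + c ∈ W) (hd : d' + d ∈ W) (he : e' + e ∈ W) :
    Claw E W c' d' e' := by
  have aux : ∀ {x x' : V} {P : Set V → Prop}, x' + x ∈ W → (x ∉ W ∧ P (fib E W x)) →
      (x' ∉ W ∧ P (fib E W x')) := by
    rintro x x' P hx ⟨h1, h2⟩
    refine ⟨fun h => h1 ((W.add_mem_iff_right h).1 hx), ?_⟩
    rwa [fib_eq_of_add_mem hx]
  have hcd : (c' + d') + (c + d) ∈ W := by convert W.add_mem hc hd using 1; abel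
  exact ⟨aux (P := Set.Nonempty) hc h.left, aux (P := Set.Nonempty) hd h.middle,
    aux (P := Set.Nonempty) he h.right,
    aux (P := (· = ∅)) hcd h.left_middle,
    aux (P := (· = ∅)) (by convert W.add_mem hc he using 1; abel) h.left_right,
    aux (P := (· = ∅)) (by convert W.add_mem hd he using 1; abel) h.middle_right,
    aux (P := (· = ∅)) (by convert W.add_mem hcd he using 1; abel) h.sum⟩

theorem Rich.le_ncard_fib_of_claw [Finite V] {E : Set V} (hE : Admissible E)
    {W : Submodule (ZMod 2) V} {j : ℕ} (hW : Rich E W j) {c d e : V} (h : Claw E W c d e)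
    (hc : (fib E W c).ncard < 2 ^ (j + 1)) (hd : (fib E W d).ncard < 2 ^ (j + 1)) :
    2 ^ (j + 1) ≤ (fib E W e).ncard := by
  by_contra! he
  obtain ⟨X, hX, hXc⟩ := exists_submodule_of_card_fib_lt h.left.2 hc
  obtain ⟨Y, hY, hYd⟩ := exists_submodule_of_card_fib_lt h.middle.2 hd
  obtain ⟨Z, hZ, hZe⟩ := exists_submodule_of_card_fib_lt h.right.2 he
  obtain ⟨p, ⟨hp, hpW⟩, q, ⟨hq, hqW⟩, hpqX, hpqY, hpqZ⟩ :=
    exists_add_notMem_of_finrank hW.span_eq j hW.finrank_eq hX hY hZ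
  have hpq : p ≠ q := by
    rintro rfl
    exact hpqX (by simp [ZModModule.add_self])
  obtain ⟨c', hc', hc''⟩ := hXc _ (W.add_mem hpW hqW) hpqX
  obtain ⟨d', hd', hd''⟩ := hYd _ (W.add_mem hpW hqW) hpqY
  obtain ⟨e', he', he''⟩ := hZe _ (W.add_mem hpW hqW) hpqZ
  have h' := h.replace hc'.2 hd'.2 he'.2
  have aux : ∀ x ∈ E, x + (p + q) ∉ E →
      ∀ u ∈ (⊥ : Submodule (ZMod 2) V) ⊔ span (ZMod 2) {p} ⊔ span (ZMod 2) {q},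
      x + u ∈ E → u = 0 := by
    intro x hx hx' u hu hxu
    rw [mem_bot_sup_span_pair] at hu
    rcases hu with rfl | rfl | rfl | rfl
    · rfl
    · exact absurd hxu (hE.add_notMem _ hx _ hp)
    · exact absurd hxu (hE.add_notMem _ hx _ hq)
    · exact absurd hxu hx'
  refine hE.not_indFlat _ ((IndFlat.pair hE.zero_notMem hE.add_notMem hp hq
    hpq).insert_outside_three (W := W) ?_ hc'.1 h'.left.1 hd'.1 h'.middle.1
    he'.1 h'.right.1 h'.left_middle.1 h'.left_right.1 h'.middle_right.1 h'.sum.1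
    (notMem_of_fib_eq_empty h'.left_middle.2) (notMem_of_fib_eq_empty h'.left_right.2)
    (notMem_of_fib_eq_empty h'.middle_right.2) (notMem_of_fib_eq_empty h'.sum.2)
    (aux _ hc'.1 hc'') (aux _ hd'.1 hd'') (aux _ he'.1 he''))
  simpa using ⟨hpW, hqW⟩

/-- Two cosets of `W` meeting `E` that form a two-element independent flat in the quotient. -/
structure IndPair (E : Set V) (W : Submodule (ZMod 2) V) (c d : V) : Prop where
  left : c ∉ W ∧ c ∈ E
  right : d ∉ W ∧ d ∈ E
  sum : c + d ∉ W ∧ fib E W (c + d) = ∅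

theorem IndPair.symm {E : Set V} {W : Submodule (ZMod 2) V} {c d : V} (h : IndPair E W c d) :
    IndPair E W d c := ⟨h.right, h.left, add_comm c d ▸ h.sum⟩

theorem Rich.exists_indPair [Finite V] {E : Set V} (hE : Admissible E)
    {W : Submodule (ZMod 2) V} {j : ℕ} (hW : Rich E W j) {c d : V} (h : IndPair E W c d) :
    ∃ c d, IndPair E W c d ∧ ∀ e ∈ E, Claw E W c d e → 2 ^ (j + 1) ≤ (fib E W e).ncard := by
  by_contra! hcon
  obtain ⟨e, he, hcde, hle⟩ := hcon c d h
  obtain ⟨f, hf, hdef, hlf⟩ := hcon d e ⟨h.right, ⟨hcde.right.1, he⟩, hcde.middle_right⟩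
  obtain ⟨g, hg, hefg, hlg⟩ := hcon e f ⟨⟨hcde.right.1, he⟩, ⟨hdef.right.1, hf⟩, hdef.middle_right⟩
  exact hlg.not_ge (hW.le_ncard_fib_of_claw hE hefg hle hlf)

theorem inter_sup_sup_eq {E : Set V} {W : Submodule (ZMod 2) V} {c d : V} (h : IndPair E W c d) :
    E ∩ (W ⊔ span (ZMod 2) {c} ⊔ span (ZMod 2) {d} : Submodule (ZMod 2) V) =
      E ∩ W ∪ (fib E W c ∪ fib E W d) := by
  ext x
  have h1 : x ∉ fib E W (c + d) := by simp [h.sum.2]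
  have h2 : x + d + c = x + (c + d) := by abel
  simp only [Set.mem_inter_iff, SetLike.mem_coe, mem_sup_span_singleton_iff, Set.mem_union, fib,
    Set.mem_ofPred_eq, h2] at h1 ⊢
  tauto

theorem ncard_inter_sup_sup [Finite V] {E : Set V} {W : Submodule (ZMod 2) V} {c d : V}
    (h : IndPair E W c d) :
    (E ∩ (W ⊔ span (ZMod 2) {c} ⊔ span (ZMod 2) {d} : Submodule (ZMod 2) V)).ncard =
      (E ∩ W).ncard + ((fib E W c).ncard + (fib E W d).ncard) := by
  have hfib : E ∩ W = fib E W 0 := by ext; simp [fib]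
  rw [inter_sup_sup_eq h, Set.ncard_union_eq, Set.ncard_union_eq (disjoint_fib h.sum.1)]
  rw [hfib, Set.disjoint_union_right]
  exact ⟨disjoint_fib (by simpa using h.left.1), disjoint_fib (by simpa using h.right.1)⟩

theorem Rich.sup_sup [Finite V] {E : Set V} {W : Submodule (ZMod 2) V} {j : ℕ} (hW : Rich E W j)
    {c d : V} (h : IndPair E W c d)
    (hclaw : ∀ e ∈ E, Claw E W c d e → 2 ^ (j + 1) ≤ (fib E W e).ncard) :
    Rich E (W ⊔ span (ZMod 2) {c} ⊔ span (ZMod 2) {d}) (j + 1) := by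
  refine ⟨?_, ?_, ?_, ?_⟩
  · rw [finrank_sup_span_singleton, finrank_sup_span_singleton h.left.1, hW.finrank_eq]
    · ring
    · rw [mem_sup_span_singleton_iff, add_comm d c]
      exact not_or.2 ⟨h.right.1, h.sum.1⟩
  · refine le_antisymm (span_le.2 Set.inter_subset_right) (sup_le (sup_le ?_ ?_) ?_)
    · conv_lhs => rw [← hW.span_eq]
      exact span_mono (Set.inter_subset_inter_right _ fun x hx => mem_sup_left (mem_sup_left hx))
    · exact span_mono (Set.singleton_subset_iff.2 ⟨h.left.2,
        mem_sup_left (mem_sup_right (mem_span_singleton_self c))⟩)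
    · exact span_mono (Set.singleton_subset_iff.2 ⟨h.right.2,
        mem_sup_right (mem_span_singleton_self d)⟩)
  · rw [ncard_inter_sup_sup h]
    have h1 := hW.le_ncard
    have h2 := hW.le_ncard_fib c h.left.1 ⟨c, mem_fib_self h.left.2⟩
    have h3 := hW.le_ncard_fib d h.right.1 ⟨d, mem_fib_self h.right.2⟩
    rw [pow_succ] at h1 ⊢
    rw [pow_succ]
    omega
  · intro e he hne
    obtain ⟨e', he'⟩ := hne
    rw [← fib_eq_of_add_mem he'.2]
    have heW : e' ∉ W ⊔ span (ZMod 2) {c} ⊔ span (ZMod 2) {d} := fun h =>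
      he ((Submodule.add_mem_iff_right _ h).1 he'.2)
    have he'E := he'.1
    clear he' he e
    simp only [mem_sup_span_singleton_iff, not_or] at heW
    obtain ⟨⟨h1, h2⟩, h3, h4⟩ := heW
    have key : ∀ t, t ∈ W ⊔ span (ZMod 2) {c} ⊔ span (ZMod 2) {d} → t ∉ W → e' + t ∉ W →
        (fib E W (e' + t)).Nonempty →
        2 ^ (j + 1) ≤ (fib E (W ⊔ span (ZMod 2) {c} ⊔ span (ZMod 2) {d}) e').ncard := by
      intro t ht htW hetW hne
      have hdisj : Disjoint (fib E W e') (fib E W (e' + t)) :=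
        disjoint_fib (by rwa [← add_assoc, ZModModule.add_self, zero_add])
      have hsub : fib E W e' ∪ fib E W (e' + t) ⊆
          fib E (W ⊔ span (ZMod 2) {c} ⊔ span (ZMod 2) {d}) e' := by
        rintro x (hx | hx)
        · exact ⟨hx.1, mem_sup_left (mem_sup_left hx.2)⟩
        · refine ⟨hx.1, ?_⟩
          convert add_mem (mem_sup_left (mem_sup_left hx.2)) ht using 1
          grind [ZModModule.add_self t]
      have := Set.ncard_le_ncard hsub
      rw [Set.ncard_union_eq hdisj] at this
      have h5 := hW.le_ncard_fib e' h1 ⟨e', mem_fib_self he'E⟩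
      have h6 := hW.le_ncard_fib (e' + t) hetW hne
      rw [pow_succ]
      omega
    have hc : c ∈ W ⊔ span (ZMod 2) {c} ⊔ span (ZMod 2) {d} :=
      mem_sup_left (mem_sup_right (mem_span_singleton_self c))
    have hd : d ∈ W ⊔ span (ZMod 2) {c} ⊔ span (ZMod 2) {d} :=
      mem_sup_right (mem_span_singleton_self d)
    have h4' : e' + (c + d) ∉ W := by rwa [add_comm c d, ← add_assoc]
    rcases (fib E W (e' + c)).eq_empty_or_nonempty with h5 | h5
    · rcases (fib E W (e' + d)).eq_empty_or_nonempty with h6 | h6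
      · rcases (fib E W (e' + (c + d))).eq_empty_or_nonempty with h7 | h7
        · have := hclaw e' he'E ⟨⟨h.left.1, c, mem_fib_self h.left.2⟩,
            ⟨h.right.1, d, mem_fib_self h.right.2⟩, ⟨h1, e', mem_fib_self he'E⟩, h.sum,
            add_comm e' c ▸ ⟨h2, h5⟩, add_comm e' d ▸ ⟨h3, h6⟩,
            add_comm e' (c + d) ▸ ⟨h4', h7⟩⟩
          refine this.trans (Set.ncard_le_ncard fun x hx => ⟨hx.1, ?_⟩)
          exact mem_sup_left (mem_sup_left hx.2)
        · exact key _ (add_mem hc hd) h.sum.1 h4' h7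
      · exact key _ hd h.right.1 h3 h6
    · exact key _ hc h.left.1 h2 h5

theorem nonempty_fib_of_forall_not_indPair {E : Set V} {W : Submodule (ZMod 2) V}
    (hspan : span (ZMod 2) E = ⊤) (h : ∀ c d, ¬ IndPair E W c d) {c : V} (hc : c ∉ W) :
    (fib E W c).Nonempty := by
  have hmem : c ∈ span (ZMod 2) E := hspan ▸ mem_top
  revert hc
  induction hmem using span_induction with
  | mem x hx => exact fun _ => ⟨x, mem_fib_self hx⟩
  | zero => exact fun h => absurd W.zero_mem h
  | add x y _ _ hx hy =>
    intro hxy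
    by_cases hxW : x ∈ W
    · rw [fib_eq_of_add_mem (d := y) (by simpa [add_assoc, ZModModule.add_self] using hxW)]
      exact hy fun hyW => hxy (W.add_mem hxW hyW)
    by_cases hyW : y ∈ W
    · rw [fib_eq_of_add_mem (d := x) (by
        convert hyW using 1; grind [ZModModule.add_self x])]
      exact hx hxW
    obtain ⟨x', hx'⟩ := hx hxW
    obtain ⟨y', hy'⟩ := hy hyW
    by_contra hempty
    have hadd : x' + y' + (x + y) ∈ W := by convert W.add_mem hx'.2 hy'.2 using 1; abel
    refine h x' y' ⟨⟨?_, hx'.1⟩, ⟨?_, hy'.1⟩, ?_, ?_⟩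
    · exact fun h => hxW ((W.add_mem_iff_right h).1 hx'.2)
    · exact fun h => hyW ((W.add_mem_iff_right h).1 hy'.2)
    · exact fun h => hxy ((W.add_mem_iff_right h).1 hadd)
    · rw [fib_eq_of_add_mem hadd]
      exact Set.not_nonempty_iff_eq_empty.1 hempty
  | smul t x _ hx =>
    obtain rfl | rfl : t = 0 ∨ t = 1 := by
      clear * -; revert t; decide
    · simp
    · simpa using hx

theorem Rich.le_ncard_of_forall_nonempty [Finite V] {E : Set V} {W : Submodule (ZMod 2) V} {j : ℕ}
    (hW : Rich E W j) (h : ∀ c, c ∉ W → (fib E W c).Nonempty) {n : ℕ}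
    (hn : Module.finrank (ZMod 2) V = 2 * j + 2 + n) :
    2 ^ (j + 1) + (2 ^ n - 1) * 2 ^ j ≤ E.ncard := by
  classical
  have := Fintype.ofFinite V
  have := Fintype.ofFinite (V ⧸ W)
  have hcardQ : Fintype.card (V ⧸ W) = 2 ^ n := by
    have h1 := Module.natCard_eq_pow_finrank (K := ZMod 2) (V := V ⧸ W)
    have h2 := finrank_quotient_add_finrank W
    rw [hW.finrank_eq, hn] at h2
    rw [Nat.card_zmod, Nat.card_eq_fintype_card] at h1
    rw [h1, show Module.finrank (ZMod 2) (V ⧸ W) = n by omega]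
  have hfib : ∀ c, ({x ∈ E.toFinset | W.mkQ x = W.mkQ c} : Finset V).card
      = (fib E W c).ncard := by
    intro c
    rw [← Set.ncard_coe_finset]
    congr 1
    ext x
    simp [fib, Submodule.Quotient.eq, ZModModule.sub_eq_add]
  have hsum := Finset.card_eq_sum_card_fiberwise (f := W.mkQ) (s := E.toFinset)
    (t := Finset.univ) (by simp)
  rw [← Finset.add_sum_erase _ _ (Finset.mem_univ 0)] at hsum
  rw [Set.ncard_eq_toFinset_card', hsum]
  refine add_le_add ?_ ?_
  · rw [← map_zero W.mkQ, hfib]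
    refine hW.le_ncard.trans_eq ?_
    congr 1
    ext
    simp [fib]
  · have hcard : (Finset.univ.erase (0 : V ⧸ W)).card = 2 ^ n - 1 := by
      rw [Finset.card_erase_of_mem (Finset.mem_univ _), Finset.card_univ, hcardQ]
    rw [← hcard, ← smul_eq_mul]
    refine Finset.card_nsmul_le_sum _ _ _ fun q hq => ?_
    obtain ⟨c, rfl⟩ := W.mkQ_surjective q
    have hc : c ∉ W := by simpa using hq
    rw [hfib]
    exact hW.le_ncard_fib c hc (h c hc)

theorem eq_zero_or_one_of_card_le {j n : ℕ}
    (h : 2 ^ (j + 1) + (2 ^ n - 1) * 2 ^ j ≤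
      2 ^ ((2 * j + 2 + n) / 2 - 1) + 2 ^ ((2 * j + 2 + n + 1) / 2 - 1)) : n = 0 ∨ n = 1 := by
  obtain ⟨u, rfl | rfl⟩ := Nat.even_or_odd' n
  · rw [show (2 * j + 2 + 2 * u) / 2 - 1 = j + u by omega,
      show (2 * j + 2 + 2 * u + 1) / 2 - 1 = j + u by omega, pow_succ, pow_add, pow_mul'] at h
    have h1 : 0 < 2 ^ j := by positivity
    have h2 : 1 ≤ (2 ^ u) ^ 2 := Nat.one_le_pow _ _ (by positivity)
    rcases Nat.eq_zero_or_pos u with rfl | hu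
    · simp
    · have h3 : 2 ≤ 2 ^ u := Nat.le_self_pow hu.ne' 2
      generalize 2 ^ u = x at *
      zify [h2] at *
      nlinarith [mul_pos h1 (by nlinarith : 0 < ((x : ℤ) - 1) ^ 2)]
  · rw [show (2 * j + 2 + (2 * u + 1)) / 2 - 1 = j + u by omega,
      show (2 * j + 2 + (2 * u + 1) + 1) / 2 - 1 = j + u + 1 by omega, pow_succ, pow_succ,
      pow_succ, pow_add, pow_mul'] at h
    have h1 : 0 < 2 ^ j := by positivity
    have h2 : 1 ≤ (2 ^ u) ^ 2 * 2 := Nat.succ_le_of_lt (by positivity)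
    rcases Nat.eq_zero_or_pos u with rfl | hu
    · simp
    · have h3 : 2 ≤ 2 ^ u := Nat.le_self_pow hu.ne' 2
      generalize 2 ^ u = x at *
      zify [h2] at *
      nlinarith [mul_pos h1 (by nlinarith : 0 < (2 * (x : ℤ) - 1) * (x - 1))]

/-- `E ∩ W` is the union of two affine geometries in complementary subspaces of `W`. -/
structure AffPair (E : Set V) (W H₁ : Submodule (ZMod 2) V) (a₁ : V) (H₂ : Submodule (ZMod 2) V)
    (a₂ : V) : Prop where
  left : a₁ ∉ H₁
  right : a₂ ∉ H₂
  disjoint : Disjoint (H₁ ⊔ span (ZMod 2) {a₁}) (H₂ ⊔ span (ZMod 2) {a₂})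
  sup_eq : H₁ ⊔ span (ZMod 2) {a₁} ⊔ (H₂ ⊔ span (ZMod 2) {a₂}) = W
  mem_iff : ∀ x, x ∈ E ∧ x ∈ W ↔ x + a₁ ∈ H₁ ∨ x + a₂ ∈ H₂

namespace AffPair

variable {E : Set V} {W H₁ H₂ : Submodule (ZMod 2) V} {a₁ a₂ : V}

theorem symm (h : AffPair E W H₁ a₁ H₂ a₂) : AffPair E W H₂ a₂ H₁ a₁ :=
  ⟨h.right, h.left, h.disjoint.symm, (sup_comm _ _).trans h.sup_eq,
    fun x => (h.mem_iff x).trans or_comm⟩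

theorem left_le (h : AffPair E W H₁ a₁ H₂ a₂) : H₁ ⊔ span (ZMod 2) {a₁} ≤ W :=
  h.sup_eq ▸ le_sup_left

theorem hyperplane_le (h : AffPair E W H₁ a₁ H₂ a₂) : H₁ ≤ W := le_sup_left.trans h.left_le

theorem add_mem_iff (h : AffPair E W H₁ a₁ H₂ a₂) {v w : V} (hv : v ∈ H₁ ⊔ span (ZMod 2) {a₁})
    (hw : w ∈ H₂ ⊔ span (ZMod 2) {a₂}) :
    v + w ∈ E ↔ (w = 0 ∧ v + a₁ ∈ H₁) ∨ (v = 0 ∧ w + a₂ ∈ H₂) := by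
  have hW : v + w ∈ W := W.add_mem (h.left_le hv) (h.symm.left_le hw)
  have ha₁ : a₁ ∈ H₁ ⊔ span (ZMod 2) {a₁} := mem_sup_right (mem_span_singleton_self _)
  have ha₂ : a₂ ∈ H₂ ⊔ span (ZMod 2) {a₂} := mem_sup_right (mem_span_singleton_self _)
  have hmem := h.mem_iff (v + w)
  simp only [hW, and_true] at hmem
  rw [hmem]
  refine or_congr ⟨fun hx => ?_, ?_⟩ ⟨fun hx => ?_, ?_⟩
  · obtain rfl : w = 0 := by
      refine disjoint_def.1 h.disjoint w ?_ hw
      refine (Submodule.add_mem_iff_right _ (add_mem hv ha₁)).1 ?_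
      convert mem_sup_left (T := span (ZMod 2) {a₁}) hx using 1
      abel
    simpa using hx
  · rintro ⟨rfl, hx⟩
    simpa using hx
  · obtain rfl : v = 0 := by
      refine disjoint_def.1 h.disjoint v hv ?_
      refine (Submodule.add_mem_iff_left _ (add_mem hw ha₂)).1 ?_
      convert mem_sup_left (T := span (ZMod 2) {a₂}) hx using 1
      abel
    simpa using hx
  · rintro ⟨rfl, hx⟩
    simpa using hx

theorem sup_span_singleton (h : AffPair E W H₁ a₁ H₂ a₂) {c : V} (hc : c ∉ W)
    (hfib : ∀ x, x ∈ E ∧ x + c ∈ W ↔ x + c ∈ H₁) :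
    AffPair E (W ⊔ span (ZMod 2) {c}) (H₁ ⊔ span (ZMod 2) {a₁ + c}) a₁ H₂ a₂ := by
  have ha₁ : a₁ ∈ W := h.left_le (mem_sup_right (mem_span_singleton_self _))
  have hcancel : ∀ x : V, x + (a₁ + c) + a₁ = x + c := fun x => by
    grind [ZModModule.add_self a₁]
  refine ⟨?_, h.right, ?_, ?_, ?_⟩
  · rw [mem_sup_span_singleton_iff]
    rintro (h' | h')
    · exact h.left h'
    · rw [← add_assoc, ZModModule.add_self, zero_add] at h'
      exact hc (h.hyperplane_le h')
  · rw [disjoint_def]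
    intro v hv hv₂
    have hvW := h.symm.left_le hv₂
    refine disjoint_def.1 h.disjoint v ?_ hv₂
    simp only [mem_sup_span_singleton_iff] at hv ⊢
    have hvac : v + (a₁ + c) ∉ H₁ := fun h' => hc <| by
      rw [← W.add_mem_iff_right ha₁, ← W.add_mem_iff_right hvW]
      exact h.hyperplane_le h'
    have hvc : v + a₁ + (a₁ + c) ∉ H₁ := fun h' => hc <| by
      rw [← W.add_mem_iff_right hvW]
      convert h.hyperplane_le h' using 1
      grind [ZModModule.add_self a₁]
    tauto
  · rw [← h.sup_eq]
    apply le_antisymm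
    · refine sup_le (sup_le (sup_le ?_ ?_) ?_) ?_
      · exact le_sup_left.trans (le_sup_left.trans le_sup_left)
      · rw [span_singleton_le_iff_mem]
        exact add_mem (mem_sup_left (mem_sup_left (mem_sup_right (mem_span_singleton_self _))))
          (mem_sup_right (mem_span_singleton_self _))
      · exact le_sup_right.trans (le_sup_left.trans le_sup_left)
      · exact le_sup_right.trans le_sup_left
    · refine sup_le (sup_le (sup_le ?_ ?_) ?_) ?_
      · exact le_sup_left.trans (le_sup_left.trans le_sup_left)
      · exact le_sup_right.trans le_sup_left
      · exact le_sup_right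
      · rw [span_singleton_le_iff_mem]
        have h1 : a₁ + c ∈ H₁ ⊔ span (ZMod 2) {a₁ + c} ⊔ span (ZMod 2) {a₁} ⊔
            (H₂ ⊔ span (ZMod 2) {a₂}) :=
          mem_sup_left (mem_sup_left (mem_sup_right (mem_span_singleton_self _)))
        have h2 : a₁ ∈ H₁ ⊔ span (ZMod 2) {a₁ + c} ⊔ span (ZMod 2) {a₁} ⊔
            (H₂ ⊔ span (ZMod 2) {a₂}) :=
          mem_sup_left (mem_sup_right (mem_span_singleton_self _))
        exact (Submodule.add_mem_iff_right _ h2).1 h1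
  · intro x
    have h1 := h.mem_iff x
    have h2 := hfib x
    have h3 : x + a₁ + (a₁ + c) = x + c := by grind [ZModModule.add_self a₁]
    simp only [mem_sup_span_singleton_iff, h3]
    tauto

/-- Affine geometries in complementary subspaces contain independent flats of dimension four. -/
theorem indFlat_four (hE : Admissible E) (h : AffPair E W H₁ a₁ H₂ a₂) {p q s t : V}
    (hp : p + a₁ ∈ H₁) (hq : q + a₁ ∈ H₁) (hs : s + a₂ ∈ H₂) (ht : t + a₂ ∈ H₂) (hpq : p ≠ q)
    (hst : s ≠ t) :
    IndFlat E 4 (⊥ ⊔ span (ZMod 2) {p} ⊔ span (ZMod 2) {q} ⊔ span (ZMod 2) {s} ⊔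
      span (ZMod 2) {t}) := by
  have hpE := ((h.mem_iff p).2 (Or.inl hp)).1
  have hqE := ((h.mem_iff q).2 (Or.inl hq)).1
  have hsE := ((h.mem_iff s).2 (Or.inr hs)).1
  have htE := ((h.mem_iff t).2 (Or.inr ht)).1
  have hp₁ := mem_sup_span_singleton_iff.2 (Or.inr hp)
  have hq₁ := mem_sup_span_singleton_iff.2 (Or.inr hq)
  have hs₂ := mem_sup_span_singleton_iff.2 (Or.inr hs)
  have ht₂ := mem_sup_span_singleton_iff.2 (Or.inr ht)
  have hs0 : s ≠ 0 := fun h0 => hE.zero_notMem (h0 ▸ hsE)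
  have ht0 : t ≠ 0 := fun h0 => hE.zero_notMem (h0 ▸ htE)
  have hst0 : t + s ≠ 0 := fun h0 => hst (by grind [ZModModule.add_self s])
  have hst₂ : t + s + a₂ ∉ H₂ := fun h' => h.right <| by
    rw [← H₂.add_mem_iff_right (add_mem hs ht)]
    convert h' using 1
    grind [ZModModule.add_self a₂]
  have hle : ⊥ ⊔ span (ZMod 2) {p} ⊔ span (ZMod 2) {q} ≤ H₁ ⊔ span (ZMod 2) {a₁} := by
    simpa using ⟨hp₁, hq₁⟩
  refine ((IndFlat.pair hE.zero_notMem hE.add_notMem hpE hqE hpq).insert hsE ?_ ?_).insert htE ?_ ?_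
  · exact fun h' => hs0 (disjoint_def.1 h.disjoint s (hle h') hs₂)
  · intro u hu hsu
    rw [add_comm, h.add_mem_iff (hle hu) hs₂] at hsu
    tauto
  · rw [mem_sup_span_singleton_iff]
    rintro (h' | h')
    · exact ht0 (disjoint_def.1 h.disjoint t (hle h') ht₂)
    · exact hst0 (disjoint_def.1 h.disjoint _ (hle h') (add_mem ht₂ hs₂))
  · intro u hu htu
    rw [mem_sup_span_singleton_iff] at hu
    rcases hu with hu | hu
    · rw [add_comm, h.add_mem_iff (hle hu) ht₂] at htu
      tauto
    · have h1 : t + u = u + s + (t + s) := by grind [ZModModule.add_self s]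
      rw [h1, h.add_mem_iff (hle hu) (add_mem ht₂ hs₂)] at htu
      tauto

theorem indFlat_three (hE : Admissible E) (h : AffPair E W H₁ a₁ H₂ a₂) {p s t : V}
    (hp : p + a₁ ∈ H₁) (hs : s + a₂ ∈ H₂) (ht : t + a₂ ∈ H₂) (hst : s ≠ t) :
    IndFlat E 3 (⊥ ⊔ span (ZMod 2) {s} ⊔ span (ZMod 2) {t} ⊔ span (ZMod 2) {p}) := by
  have hpE := ((h.mem_iff p).2 (Or.inl hp)).1
  have hsE := ((h.mem_iff s).2 (Or.inr hs)).1
  have htE := ((h.mem_iff t).2 (Or.inr ht)).1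
  have hp₁ := mem_sup_span_singleton_iff.2 (Or.inr hp)
  have hs₂ := mem_sup_span_singleton_iff.2 (Or.inr hs)
  have ht₂ := mem_sup_span_singleton_iff.2 (Or.inr ht)
  have hp0 : p ≠ 0 := fun h0 => hE.zero_notMem (h0 ▸ hpE)
  have hle : ⊥ ⊔ span (ZMod 2) {s} ⊔ span (ZMod 2) {t} ≤ H₂ ⊔ span (ZMod 2) {a₂} := by
    simpa using ⟨hs₂, ht₂⟩
  refine (IndFlat.pair hE.zero_notMem hE.add_notMem hsE htE hst).insert hpE ?_ ?_
  · exact fun h' => hp0 (disjoint_def.1 h.disjoint p hp₁ (hle h'))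
  · intro u hu hpu
    rw [h.add_mem_iff hp₁ (hle hu)] at hpu
    tauto

end AffPair

theorem exists_add_notMem_of_ncard_lt [Finite V] {H : Submodule (ZMod 2) V} {a : V} {D : Set V}
    (ha : a ∉ H) (hD : D.ncard < (H : Set V).ncard) :
    ∃ s t, s + a ∈ H ∧ t + a ∈ H ∧ s ∉ D ∧ t ∉ D ∧ t + s ∉ D := by
  set P : Set V := {y | y ∈ H ∧ a + y ∈ D} with hP
  set Q : Set V := {y | y ∈ H ∧ y ∈ D} with hQ
  have hPQ : P.ncard + Q.ncard ≤ D.ncard := by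
    rw [← Set.ncard_image_of_injective P (add_right_injective a), ← Set.ncard_union_eq]
    · refine Set.ncard_le_ncard ?_
      rintro _ (⟨y, hy, rfl⟩ | hy)
      · exact hy.2
      · exact hy.2
    · rw [Set.disjoint_left]
      rintro _ ⟨y, hy, rfl⟩ hy'
      exact ha ((H.add_mem_iff_left hy.1).1 hy'.1)
  have key : ∀ y, ∃ z ∈ (H : Set V), z ∉ P ∪ (y + ·) '' Q := fun y => by
    refine Set.exists_mem_notMem_of_ncard_lt_ncard ?_
    have h1 := Set.ncard_union_le P ((y + ·) '' Q)
    rw [Set.ncard_image_of_injective Q (add_right_injective y)] at h1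
    omega
  obtain ⟨y, hy, hy'⟩ := key 0
  obtain ⟨z, hz, hz'⟩ := key y
  simp only [SetLike.mem_coe] at hy hz
  simp only [Set.mem_union, not_or] at hy' hz'
  have hcancel : ∀ y : V, a + y + a = y := fun y => by grind [ZModModule.add_self a]
  refine ⟨a + y, a + z, by rwa [hcancel], by rwa [hcancel], fun h => hy'.1 ⟨hy, h⟩,
    fun h => hz'.1 ⟨hz, h⟩, fun h => hz'.2 ⟨y + z, ⟨add_mem hy hz, ?_⟩, ?_⟩⟩
  · convert h using 1
    grind [ZModModule.add_self a]
  · grind [ZModModule.add_self y]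

theorem exists_mem_ne_of_two_le [Finite V] {H : Submodule (ZMod 2) V} {j : ℕ} (hj : 2 ≤ j)
    (hH : Module.finrank (ZMod 2) H = j) (x y : V) : ∃ z ∈ H, z ≠ x ∧ z ≠ y := by
  have h1 : ({x, y} : Set V).ncard < (H : Set V).ncard := by
    rw [card_submodule, hH]
    have h2 := Set.ncard_insert_le x {y}
    have h3 := Nat.pow_le_pow_right (n := 2) (by norm_num) hj
    rw [Set.ncard_singleton] at h2
    omega
  obtain ⟨z, hz, hz'⟩ := Set.exists_mem_notMem_of_ncard_lt_ncard h1
  exact ⟨z, hz, by simpa using hz'⟩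

theorem ncard_setOf_add_mem [Finite V] (E : Set V) (W : Submodule (ZMod 2) V) (c : V) :
    {w | w ∈ W ∧ c + w ∈ E}.ncard = (fib E W c).ncard := by
  rw [← Set.ncard_image_of_injective _ (add_right_injective c)]
  congr 1
  ext x
  constructor
  · rintro ⟨w, ⟨hw, hw'⟩, rfl⟩
    exact ⟨hw', by convert hw using 1; grind [ZModModule.add_self c]⟩
  · rintro ⟨hx, hx'⟩
    have : c + (x + c) = x := by grind [ZModModule.add_self c]
    exact ⟨x + c, ⟨hx', by rwa [this]⟩, this⟩

namespace AffPair

variable {E : Set V} {W H₁ H₂ : Submodule (ZMod 2) V} {a₁ a₂ : V}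

theorem false_of_add_notMem [Finite V] (hE : Admissible E) (h : AffPair E W H₁ a₁ H₂ a₂) {j : ℕ}
    (hj : 2 ≤ j) (h₁ : Module.finrank (ZMod 2) H₁ = j) (h₂ : Module.finrank (ZMod 2) H₂ = j)
    {c : V} (hc : c ∈ E) (hcW : c ∉ W) (hcard : (fib E W c).ncard ≤ 2 ^ j) {y v w : V}
    (hy : y ∈ H₁) (hyc : c + y ∉ E) (hv : v ∈ H₁ ⊔ span (ZMod 2) {a₁})
    (hw : w ∈ H₂ ⊔ span (ZMod 2) {a₂}) (hvw : c + (v + w) ∈ E) (hv0 : v ≠ 0) (hvy : v ≠ y) :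
    False := by
  obtain ⟨z, hz, hzv, hzvy⟩ := exists_mem_ne_of_two_le hj h₁ (v + a₁) (v + a₁ + y)
  obtain ⟨p, rfl⟩ : ∃ p, z = p + a₁ := ⟨z + a₁, by simp [add_assoc, ZModModule.add_self]⟩
  have hpy : p + y + a₁ ∈ H₁ := by
    convert add_mem hz hy using 1
    abel
  have hpv : v ≠ p := fun h => hzv (by rw [h])
  have hpyv : v ≠ p + y := fun h => hzvy (by rw [h]; grind [ZModModule.add_self y])
  set T : Submodule (ZMod 2) V := ⊥ ⊔ span (ZMod 2) {p} ⊔ span (ZMod 2) {p + y} with hT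
  have hTmem : ∀ t, t ∈ T ↔ t = 0 ∨ t = p ∨ t = p + y ∨ t = y := by
    intro t
    have : p + (p + y) = y := by grind [ZModModule.add_self p]
    rw [hT, mem_bot_sup_span_pair, this]
  have hp₁ := mem_sup_span_singleton_iff.2 (Or.inr hz)
  have hpy₁ := mem_sup_span_singleton_iff.2 (Or.inr hpy)
  have hTle : T ≤ H₁ ⊔ span (ZMod 2) {a₁} := by
    simpa [hT] using ⟨hp₁, hpy₁⟩
  have hvT : v ∉ T := by
    rw [hTmem]
    tauto
  set D : Set V := {x | x ∈ H₂ ⊔ span (ZMod 2) {a₂} ∧ ∃ t ∈ T, c + (t + x) ∈ E} with hD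
  have hDcard : D.ncard < (H₂ : Set V).ncard := by
    rw [card_submodule, h₂]
    choose! f hf hfE using fun x (hx : x ∈ D) => hx.2
    refine lt_of_lt_of_le ?_ ((ncard_setOf_add_mem E W c).trans_le hcard)
    have hinj : Set.InjOn (fun x => f x + x) D := by
      intro x hx x' hx' hxx
      have h1 : f x + f x' = x + x' := by
        grind [ZModModule.add_self (f x'), ZModModule.add_self x]
      have h2 : x + x' = 0 := disjoint_def.1 h.disjoint _
        (h1 ▸ hTle (add_mem (hf x hx) (hf x' hx'))) (add_mem hx.1 hx'.1)
      grind [ZModModule.add_self x']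
    rw [← hinj.ncard_image]
    refine Set.ncard_lt_ncard ⟨?_, fun hsub => ?_⟩
    · rintro _ ⟨x, hx, rfl⟩
      exact ⟨add_mem (h.left_le (hTle (hf x hx))) (h.symm.left_le hx.1), hfE x hx⟩
    · obtain ⟨x, hx, hxv⟩ := hsub ⟨add_mem (h.left_le hv) (h.symm.left_le hw), hvw⟩
      have h1 : f x + v = x + w := by
        grind [ZModModule.add_self v, ZModModule.add_self x]
      have h2 : f x + v = 0 := disjoint_def.1 h.disjoint _
        (add_mem (hTle (hf x hx)) hv) (h1 ▸ add_mem hx.1 hw)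
      refine hvT ?_
      rw [← T.add_mem_iff_right (hf x hx), h2]
      exact T.zero_mem
  obtain ⟨s, t, hs, ht, hsD, htD, hstD⟩ := exists_add_notMem_of_ncard_lt
    (D := D) h.right hDcard
  have hs₂ := mem_sup_span_singleton_iff.2 (Or.inr hs)
  have ht₂ := mem_sup_span_singleton_iff.2 (Or.inr ht)
  have hst : s ≠ t := by
    rintro rfl
    refine hstD ⟨add_mem hs₂ hs₂, 0, zero_mem _, by simpa [ZModModule.add_self] using hc⟩
  have hppy : p ≠ p + y := fun h' => hyc (by
    have : y = 0 := by simpa using h'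
    simpa [this] using hc)
  refine hE.not_indFlat _ ((h.indFlat_four hE hz hpy hs ht hppy hst).insert_outside
    (W := W) ?_ hc hcW ?_)
  · exact sup_le (sup_le (hTle.trans h.left_le) (by simpa using h.symm.left_le hs₂))
      (by simpa using h.symm.left_le ht₂)
  · intro u hu hcu
    simp only [mem_sup_span_singleton_iff (g := s), mem_sup_span_singleton_iff (g := t)] at hu
    have cancel : ∀ x y : V, x + y + y = x := fun x y => by
      simp [add_assoc, ZModModule.add_self]
    rcases hu with (hu | hu) | (hu | hu)
    · rcases (hTmem u).1 hu with rfl | rfl | rfl | rfl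
      · rfl
      · exact absurd hcu (hE.add_notMem _ hc _ ((h.mem_iff _).2 (Or.inl hz)).1)
      · exact absurd hcu (hE.add_notMem _ hc _ ((h.mem_iff _).2 (Or.inl hpy)).1)
      · exact absurd hcu hyc
    · exact absurd ⟨hs₂, _, hu, by rwa [cancel]⟩ hsD
    · exact absurd ⟨ht₂, _, hu, by rwa [cancel]⟩ htD
    · refine absurd ⟨add_mem ht₂ hs₂, _, hu, ?_⟩ hstD
      convert hcu using 1
      grind [ZModModule.add_self s, ZModModule.add_self t]

theorem mem_iff_of_forall_add_mem [Finite V] (h : AffPair E W H₁ a₁ H₂ a₂) {j : ℕ}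
    (h₁ : Module.finrank (ZMod 2) H₁ = j) {c : V} (hcard : (fib E W c).ncard = 2 ^ j)
    (hmem : ∀ y ∈ H₁, c + y ∈ E) (x : V) : x ∈ E ∧ x + c ∈ W ↔ x + c ∈ H₁ := by
  have hsub : (H₁ : Set V) ⊆ {w | w ∈ W ∧ c + w ∈ E} := fun y hy =>
    ⟨h.hyperplane_le hy, hmem y hy⟩
  have heq := Set.eq_of_subset_of_ncard_le hsub
    (by rw [ncard_setOf_add_mem, hcard, card_submodule, h₁]) (Set.toFinite _)
  have hx : x + c ∈ H₁ ↔ x + c ∈ {w | w ∈ W ∧ c + w ∈ E} := by rw [← heq]; rfl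
  have hcancel : c + (x + c) = x := by grind [ZModModule.add_self c]
  rw [hx, Set.mem_ofPred_eq, hcancel, and_comm]

theorem mem_iff_or_mem_iff [Finite V] (hE : Admissible E) (h : AffPair E W H₁ a₁ H₂ a₂) {j : ℕ}
    (hj : 2 ≤ j) (h₁ : Module.finrank (ZMod 2) H₁ = j) (h₂ : Module.finrank (ZMod 2) H₂ = j)
    {c : V} (hc : c ∈ E) (hcW : c ∉ W) (hcard : (fib E W c).ncard = 2 ^ j) :
    (∀ x, x ∈ E ∧ x + c ∈ W ↔ x + c ∈ H₁) ∨ ∀ x, x ∈ E ∧ x + c ∈ W ↔ x + c ∈ H₂ := by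
  by_cases h₁c : ∀ y ∈ H₁, c + y ∈ E
  · exact Or.inl (h.mem_iff_of_forall_add_mem h₁ hcard h₁c)
  by_cases h₂c : ∀ y ∈ H₂, c + y ∈ E
  · exact Or.inr (h.symm.mem_iff_of_forall_add_mem h₂ hcard h₂c)
  exfalso
  push Not at h₁c h₂c
  obtain ⟨y, hy, hyc⟩ := h₁c
  obtain ⟨z, hz, hzc⟩ := h₂c
  have hlt : ({0, y + z} : Set V).ncard < {w | w ∈ W ∧ c + w ∈ E}.ncard := by
    rw [ncard_setOf_add_mem, hcard]
    have h1 := Set.ncard_insert_le 0 {y + z}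
    have h2 := Nat.pow_le_pow_right (n := 2) (by norm_num) hj
    rw [Set.ncard_singleton] at h1
    omega
  obtain ⟨w, ⟨hw, hwE⟩, hne⟩ := Set.exists_mem_notMem_of_ncard_lt_ncard hlt
  rw [← h.sup_eq] at hw
  obtain ⟨w₁, hw₁, w₂, hw₂, rfl⟩ := mem_sup.1 hw
  have h₁w := h.false_of_add_notMem hE hj h₁ h₂ hc hcW hcard.le hy hyc hw₁ hw₂ hwE
  rw [add_comm w₁] at hwE
  have h₂w := h.symm.false_of_add_notMem hE hj h₂ h₁ hc hcW hcard.le hz hzc hw₂ hw₁ hwE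
  have hyE : w₁ = y → w₂ = 0 → False := by
    rintro rfl rfl
    exact hyc (by simpa using hwE)
  have hzE : w₁ = 0 → w₂ = z → False := by
    rintro rfl rfl
    exact hzc (by simpa using hwE)
  grind

theorem false_of_mem_iff [Finite V] (hE : Admissible E) (h : AffPair E W H₁ a₁ H₂ a₂) {j : ℕ}
    (hj : 2 ≤ j) (h₂ : Module.finrank (ZMod 2) H₂ = j) {c d : V} (hcd : IndPair E W c d)
    (hc : ∀ x, x ∈ E ∧ x + c ∈ W ↔ x + c ∈ H₁) (hd : ∀ x, x ∈ E ∧ x + d ∈ W ↔ x + d ∈ H₁) :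
    False := by
  obtain ⟨z, hz, hz0, -⟩ := exists_mem_ne_of_two_le hj h₂ 0 0
  have ha₁ : a₁ ∈ H₁ ⊔ span (ZMod 2) {a₁} := mem_sup_right (mem_span_singleton_self _)
  have ha₂ : a₂ ∈ H₂ ⊔ span (ZMod 2) {a₂} := mem_sup_right (mem_span_singleton_self _)
  have hle : ⊥ ⊔ span (ZMod 2) {a₂} ⊔ span (ZMod 2) {a₂ + z} ≤ H₂ ⊔ span (ZMod 2) {a₂} :=
    sup_le (sup_le bot_le ((span_singleton_le_iff_mem _ _).2 ha₂))
      ((span_singleton_le_iff_mem _ _).2 (add_mem ha₂ (mem_sup_left hz)))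
  have hUW : ⊥ ⊔ span (ZMod 2) {a₂} ⊔ span (ZMod 2) {a₂ + z} ⊔ span (ZMod 2) {a₁} ≤ W :=
    sup_le (hle.trans h.symm.left_le) (by simpa using h.left_le ha₁)
  have key : ∀ c, (∀ x, x ∈ E ∧ x + c ∈ W ↔ x + c ∈ H₁) →
      ∀ u ∈ ⊥ ⊔ span (ZMod 2) {a₂} ⊔ span (ZMod 2) {a₂ + z} ⊔ span (ZMod 2) {a₁},
      c + u ∈ E → u = 0 := by
    intro c hc u hu hcu
    have hcancel : c + u + c = u := by grind [ZModModule.add_self c]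
    have hu₁ : u ∈ H₁ := by
      have := (hc (c + u)).1
      rw [hcancel] at this
      exact this ⟨hcu, hUW hu⟩
    rcases mem_sup_span_singleton_iff.1 hu with hu | hu
    · exact disjoint_def.1 h.disjoint u (mem_sup_left hu₁) (hle hu)
    · have h0 := disjoint_def.1 h.disjoint _ (add_mem (mem_sup_left hu₁) ha₁) (hle hu)
      refine absurd ?_ h.left
      rw [← H₁.add_mem_iff_right hu₁, h0]
      exact H₁.zero_mem
  refine hE.not_indFlat _ ((h.indFlat_three hE (p := a₁) (s := a₂) (t := a₂ + z) ?_ ?_ ?_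
    ?_).insert_outside_two hUW hcd.left.2 hcd.left.1 hcd.right.2 hcd.right.1 hcd.sum.1
    (notMem_of_fib_eq_empty hcd.sum.2) (key c hc) (key d hd))
  · simp [ZModModule.add_self]
  · simp [ZModModule.add_self]
  · convert hz using 1
    grind [ZModModule.add_self a₂]
  · simpa using hz0

theorem finrank_sup_span_singleton (h : AffPair E W H₁ a₁ H₂ a₂) [Finite V] {c : V}
    (hc : c ∉ W) {j : ℕ} (h₁ : Module.finrank (ZMod 2) H₁ = j) :
    Module.finrank (ZMod 2) (H₁ ⊔ span (ZMod 2) {a₁ + c} : Submodule (ZMod 2) V) = j + 1 := by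
  rw [Submodule.finrank_sup_span_singleton, h₁]
  intro h'
  exact hc ((W.add_mem_iff_right (h.left_le (mem_sup_right (mem_span_singleton_self _)))).1
    (h.hyperplane_le h'))

end AffPair

/-- `E ∩ W` is the union of two affine geometries of dimension `j + 1` in complementary subspaces
of `W`. -/
def Struct (E : Set V) (W : Submodule (ZMod 2) V) (j : ℕ) : Prop :=
  ∃ (H₁ H₂ : Submodule (ZMod 2) V) (a₁ a₂ : V), AffPair E W H₁ a₁ H₂ a₂ ∧
    Module.finrank (ZMod 2) H₁ = j ∧ Module.finrank (ZMod 2) H₂ = j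

theorem AffPair.struct_sup_sup [Finite V] {E : Set V} {W H₁ H₂ : Submodule (ZMod 2) V} {a₁ a₂ : V}
    (h : AffPair E W H₁ a₁ H₂ a₂) {j : ℕ} (h₁ : Module.finrank (ZMod 2) H₁ = j)
    (h₂ : Module.finrank (ZMod 2) H₂ = j) {c d : V} (hcd : IndPair E W c d)
    (hc : ∀ x, x ∈ E ∧ x + c ∈ W ↔ x + c ∈ H₁) (hd : ∀ x, x ∈ E ∧ x + d ∈ W ↔ x + d ∈ H₂) :
    Struct E (W ⊔ span (ZMod 2) {c} ⊔ span (ZMod 2) {d}) (j + 1) := by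
  have h' := h.sup_span_singleton hcd.left.1 hc
  have hdW : d ∉ W ⊔ span (ZMod 2) {c} := by
    rw [mem_sup_span_singleton_iff, add_comm d c]
    exact not_or.2 ⟨hcd.right.1, hcd.sum.1⟩
  refine ⟨_, _, _, _, (h'.symm.sup_span_singleton hdW fun x => ?_).symm,
    h.finrank_sup_span_singleton hcd.left.1 h₁, h.symm.finrank_sup_span_singleton hcd.right.1 h₂⟩
  rw [← hd x, mem_sup_span_singleton_iff]
  refine and_congr_right fun hx => or_iff_left fun hxW => ?_
  refine (hcd.sum.2 ▸ Set.notMem_empty x : x ∉ fib E W (c + d)) ⟨hx, ?_⟩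
  convert hxW using 1
  abel

theorem Struct.sup_sup [Finite V] {E : Set V} (hE : Admissible E) {W : Submodule (ZMod 2) V}
    {j : ℕ} (hj : 2 ≤ j) (h : Struct E W j) {c d : V} (hcd : IndPair E W c d)
    (hc : (fib E W c).ncard = 2 ^ j) (hd : (fib E W d).ncard = 2 ^ j) :
    Struct E (W ⊔ span (ZMod 2) {c} ⊔ span (ZMod 2) {d}) (j + 1) := by
  obtain ⟨H₁, H₂, a₁, a₂, h, h₁, h₂⟩ := h
  rcases h.mem_iff_or_mem_iff hE hj h₁ h₂ hcd.left.2 hcd.left.1 hc with hc' | hc' <;>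
  rcases h.mem_iff_or_mem_iff hE hj h₁ h₂ hcd.right.2 hcd.right.1 hd with hd' | hd'
  · exact (h.false_of_mem_iff hE hj h₂ hcd hc' hd').elim
  · exact h.struct_sup_sup h₁ h₂ hcd hc' hd'
  · exact h.symm.struct_sup_sup h₂ h₁ hcd hc' hd'
  · exact (h.symm.false_of_mem_iff hE hj h₁ hcd hc' hd').elim

theorem mem_span_singleton_two {x y : V} : x ∈ span (ZMod 2) {y} ↔ x = 0 ∨ x = y := by
  have h := mem_sup_span_singleton_iff (U := ⊥) (g := y) (x := x)
  rw [bot_sup_eq, mem_bot, mem_bot] at h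
  rw [h]
  refine or_congr_right ⟨fun h => ?_, fun h => ?_⟩
  · grind [ZModModule.add_self y]
  · rw [h, ZModModule.add_self]

theorem exists_pair_of_ncard_fib_eq_two {E : Set V} {W : Submodule (ZMod 2) V} {c : V}
    (hc : c ∈ E) (hcard : (fib E W c).ncard = 2) :
    ∃ y, y ≠ 0 ∧ y ∈ W ∧ c + y ∈ E ∧ ∀ x, x ∈ E ∧ x + c ∈ W ↔ x + c ∈ span (ZMod 2) {y} := by
  obtain ⟨p, q, hpq, heq⟩ := Set.ncard_eq_two.1 hcard
  have key : ∀ q, c ≠ q → fib E W c = {c, q} →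
      ∃ y, y ≠ 0 ∧ y ∈ W ∧ c + y ∈ E ∧ ∀ x, x ∈ E ∧ x + c ∈ W ↔ x + c ∈ span (ZMod 2) {y} := by
    intro q hpq heq
    have hq : q ∈ fib E W c := heq ▸ Set.mem_insert_of_mem _ rfl
    have hcancel : c + (q + c) = q := by grind [ZModModule.add_self c]
    refine ⟨q + c, fun h => hpq ?_, hq.2, by rw [hcancel]; exact hq.1, fun x => ?_⟩
    · grind [ZModModule.add_self c]
    · change x ∈ fib E W c ↔ _
      rw [heq, mem_span_singleton_two, Set.mem_insert_iff, Set.mem_singleton_iff]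
      refine or_congr ⟨fun h => ?_, fun h => ?_⟩ ⟨fun h => ?_, fun h => ?_⟩
      · rw [h, ZModModule.add_self]
      · grind [ZModModule.add_self c]
      · rw [h]
      · exact add_right_cancel h
  have hmem : c ∈ ({p, q} : Set V) := heq ▸ mem_fib_self hc
  rcases hmem with rfl | rfl
  · exact key q hpq heq
  · exact key p hpq.symm (by rw [heq, Set.pair_comm])

theorem indFlat_span_image_compl {E : Set V} {W : Submodule (ZMod 2) V} {n : ℕ}
    {v : Fin (n + 1) → V} (hv : LinearIndependent (ZMod 2) v) (hE : E ∩ W = Set.range v)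
    (i : Fin (n + 1)) :
    IndFlat E n (span (ZMod 2) (v '' {i}ᶜ)) := by
  have hrange : Set.range (v ∘ i.succAbove) = v '' {i}ᶜ := by
    rw [Set.range_comp, Fin.range_succAbove]
  have hvE : Set.range v ⊆ E ∩ W := hE.ge
  refine ⟨v ∘ i.succAbove, hv.comp _ Fin.succAbove_right_injective, by rw [hrange], ?_⟩
  rw [hrange]
  ext x
  constructor
  · rintro ⟨hxE, hx⟩
    have hxW : x ∈ W := span_le.2 ((Set.image_subset_range _ _).trans
      (hvE.trans Set.inter_subset_right)) hx
    obtain ⟨k, rfl⟩ := hE.le ⟨hxE, hxW⟩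
    exact ⟨k, fun hk => hv.notMem_span_image (s := {i}ᶜ) (x := k) (by simpa using hk) hx, rfl⟩
  · exact fun hx => ⟨(hvE (Set.image_subset_range _ _ hx)).1, subset_span hx⟩

theorem exists_perm_of_disjoint_support (f g : Fin 4 → ZMod 2) (hfg : ∀ i, f i = 0 ∨ g i = 0)
    (hf : ∃ i j, i ≠ j ∧ f i = 1 ∧ f j = 1) (hg : ∃ i j, i ≠ j ∧ g i = 1 ∧ g j = 1) :
    ∃ σ : Equiv.Perm (Fin 4), (∀ i, f (σ i) = ![1, 1, 0, 0] i) ∧ ∀ i, g (σ i) = ![0, 0, 1, 1] i := by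
  obtain ⟨i, j, hij, hi, hj⟩ := hf
  obtain ⟨k, l, hkl, hk, hl⟩ := hg
  have hf0 : ∀ i, g i = 1 → f i = 0 := fun i hi => (hfg i).resolve_right (by simp [hi])
  have hg0 : ∀ i, f i = 1 → g i = 0 := fun i hi => (hfg i).resolve_left (by simp [hi])
  have hne : ∀ i k, f i = 1 → g k = 1 → i ≠ k := by
    rintro i _ hi hk rfl
    simp [hf0 i hk] at hi
  have hinj : Function.Injective ![i, j, k, l] := by
    intro x y
    have hik := hne i k hi hk
    have hil := hne i l hi hl
    have hjk := hne j k hj hk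
    have hjl := hne j l hj hl
    fin_cases x <;> fin_cases y <;> simp_all [eq_comm]
  refine ⟨Equiv.ofBijective _ (Finite.injective_iff_bijective.1 hinj), fun x => ?_, fun x => ?_⟩
  · fin_cases x <;> simp [hi, hj, hf0 k hk, hf0 l hl]
  · fin_cases x <;> simp [hk, hl, hg0 i hi, hg0 j hj]

theorem exists_ne_coeff_eq_one {n : ℕ} {v : Fin n → V} {f : Fin n → ZMod 2}
    (h0 : ∑ i, f i • v i ≠ 0) (h : ∀ k, ∑ i, f i • v i ≠ v k) :
    ∃ i j, i ≠ j ∧ f i = 1 ∧ f j = 1 := by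
  have hf : ∀ k, f k ≠ 1 → f k = 0 := fun k => by
    generalize f k = t
    revert t
    decide
  by_contra! hcon
  by_cases hk : ∃ k, f k = 1
  · obtain ⟨k, hk⟩ := hk
    refine h k ?_
    rw [Finset.sum_eq_single k, hk, one_smul]
    · intro l _ hl
      rw [hf l (hcon k l hl.symm hk), zero_smul]
    · simp
  · push Not at hk
    exact h0 (Finset.sum_eq_zero fun k _ => by rw [hf k (hk k), zero_smul])

theorem Rich.exists_range_eq [Finite V] {E : Set V} {W : Submodule (ZMod 2) V} (hW : Rich E W 1)
    (hcard : (E ∩ W).ncard = 4) :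
    ∃ v : Fin 4 → V, LinearIndependent (ZMod 2) v ∧ E ∩ W = Set.range v := by
  have hc : Nat.card ↑(E ∩ W : Set V) = 4 := hcard
  let e := Finite.equivFinOfCardEq hc
  have hrange : Set.range (fun i => (e.symm i : V)) = E ∩ W := by
    rw [show (fun i => (e.symm i : V)) = Subtype.val ∘ e.symm from rfl, Set.range_comp,
      e.symm.surjective.range_eq, Set.image_univ, Subtype.range_coe]
  refine ⟨fun i => (e.symm i : V), ?_, hrange.symm⟩
  rw [linearIndependent_iff_card_eq_finrank_span, Set.finrank, hrange, hW.span_eq, hW.finrank_eq]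
  rfl

theorem affPair_of_range_eq {E : Set V} {W : Submodule (ZMod 2) V} {v : Fin 4 → V}
    (hv : LinearIndependent (ZMod 2) v) (hspan : span (ZMod 2) (Set.range v) = W)
    (hE : E ∩ W = Set.range v) :
    AffPair E W (span (ZMod 2) {v 0 + v 1}) (v 0) (span (ZMod 2) {v 2 + v 3}) (v 2) := by
  have hleft : ∀ i j, i ≠ j → v i ∉ span (ZMod 2) {v i + v j} := by
    intro i j hij h
    rcases mem_span_singleton_two.1 h with h | h
    · exact hv.ne_zero i h
    · exact hv.ne_zero j (by simpa using h)
  have hle : ∀ i j, span (ZMod 2) {v i + v j} ⊔ span (ZMod 2) {v i} =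
      span (ZMod 2) (v '' {i, j}) := by
    intro i j
    have hi := subset_span (R := ZMod 2) (Set.mem_image_of_mem v (Set.mem_insert i {j}))
    have hj := subset_span (R := ZMod 2)
      (Set.mem_image_of_mem v (Set.mem_insert_of_mem i (Set.mem_singleton j)))
    apply le_antisymm
    · exact sup_le ((span_singleton_le_iff_mem _ _).2 (add_mem hi hj))
        ((span_singleton_le_iff_mem _ _).2 hi)
    · rw [span_le, Set.image_pair, Set.pair_subset_iff]
      refine ⟨mem_sup_right (mem_span_singleton_self _), ?_⟩
      rw [SetLike.mem_coe, mem_sup_span_singleton_iff, add_comm (v j)]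
      exact Or.inr (mem_span_singleton_self _)
  refine ⟨hleft 0 1 (by decide), hleft 2 3 (by decide), ?_, ?_, fun x => ?_⟩
  · rw [hle, hle]
    exact hv.disjoint_span_image (by simp)
  · rw [hle, hle, ← span_union, ← Set.image_union, ← hspan, ← Set.image_univ]
    congr 2
    ext i
    fin_cases i <;> simp
  · rw [← SetLike.mem_coe, ← Set.mem_inter_iff, hE, mem_span_singleton_two, mem_span_singleton_two]
    have h : ∀ i j, x + v i = 0 ∨ x + v i = v i + v j ↔ x = v i ∨ x = v j := by
      intro i j
      have := ZModModule.add_self (v i)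
      grind
    rw [h, h]
    simp [Fin.exists_fin_succ, eq_comm, or_assoc]

theorem Rich.struct_sup_sup [Finite V] {E : Set V} (hE : Admissible E) {W : Submodule (ZMod 2) V}
    (hW : Rich E W 1) (hcard : (E ∩ W).ncard = 4) {c d : V} (hcd : IndPair E W c d)
    (hc : (fib E W c).ncard = 2) (hd : (fib E W d).ncard = 2) :
    Struct E (W ⊔ span (ZMod 2) {c} ⊔ span (ZMod 2) {d}) 2 := by
  obtain ⟨v, hv, hrange⟩ := hW.exists_range_eq hcard
  obtain ⟨y, hy0, hyW, hy, hyc⟩ := exists_pair_of_ncard_fib_eq_two hcd.left.2 hc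
  obtain ⟨z, hz0, hzW, hz, hzd⟩ := exists_pair_of_ncard_fib_eq_two hcd.right.2 hd
  have hspan : span (ZMod 2) (Set.range v) = W := hrange ▸ hW.span_eq
  have hvE : ∀ k, v k ∈ E ∩ W := fun k => hrange ▸ Set.mem_range_self k
  obtain ⟨f, rfl⟩ := (mem_span_range_iff_exists_fun _).1 (hspan ▸ hyW)
  obtain ⟨g, rfl⟩ := (mem_span_range_iff_exists_fun _).1 (hspan ▸ hzW)
  have hcoeff : ∀ (f : Fin 4 → ZMod 2) i, f i ≠ 0 →
      ∑ i, f i • v i ∉ span (ZMod 2) (v '' {i}ᶜ) := by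
    intro f i hfi hmem
    have hfi : f i = 1 := by
      generalize f i = t at hfi
      revert t
      decide
    rw [Fin.sum_univ_succAbove _ i, hfi, one_smul, Submodule.add_mem_iff_left] at hmem
    · exact hv.notMem_span_image (s := {i}ᶜ) (by simp) hmem
    · exact sum_mem fun k _ => smul_mem _ _ (subset_span ⟨_, Fin.succAbove_ne i k, rfl⟩)
  have hfg : ∀ i, f i = 0 ∨ g i = 0 := by
    intro i
    by_contra! hi
    have hle : span (ZMod 2) (v '' {i}ᶜ) ≤ W := hspan ▸ span_mono (Set.image_subset_range _ _)
    have key : ∀ (c : V) (f : Fin 4 → ZMod 2), f i ≠ 0 →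
        (∀ x, x ∈ E ∧ x + c ∈ W ↔ x + c ∈ span (ZMod 2) {∑ i, f i • v i}) →
        ∀ u ∈ span (ZMod 2) (v '' {i}ᶜ), c + u ∈ E → u = 0 := by
      intro c f hfi hfib u hu hcu
      have hcancel : c + u + c = u := by grind [ZModModule.add_self c]
      have := (hfib (c + u)).1
      rw [hcancel, mem_span_singleton_two] at this
      refine (this ⟨hcu, hle hu⟩).resolve_right fun h => hcoeff f i hfi ?_
      rwa [← h]
    exact hE.not_indFlat _ ((indFlat_span_image_compl hv hrange i).insert_outside_two hle
      hcd.left.2 hcd.left.1 hcd.right.2 hcd.right.1 hcd.sum.1 (notMem_of_fib_eq_empty hcd.sum.2)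
      (key c f hi.1 hyc) (key d g hi.2 hzd))
  obtain ⟨σ, hfσ, hgσ⟩ := exists_perm_of_disjoint_support f g hfg
    (exists_ne_coeff_eq_one hy0 fun k hk => hE.add_notMem c hcd.left.2 _ (hvE k).1 (hk ▸ hy))
    (exists_ne_coeff_eq_one hz0 fun k hk => hE.add_notMem d hcd.right.2 _ (hvE k).1 (hk ▸ hz))
  have hfsum : ∑ i, f i • v i = v (σ 0) + v (σ 1) := by
    rw [← Equiv.sum_comp σ]
    simp [hfσ, Fin.sum_univ_four]
  have hgsum : ∑ i, g i • v i = v (σ 2) + v (σ 3) := by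
    rw [← Equiv.sum_comp σ]
    simp [hgσ, Fin.sum_univ_four]
  rw [hfsum] at hyc hy0
  rw [hgsum] at hzd hz0
  have hrangeσ : Set.range v = Set.range (v ∘ σ) := (σ.surjective.range_comp v).symm
  rw [hrangeσ] at hrange hspan
  exact (affPair_of_range_eq (hv.comp σ σ.injective) hspan hrange).struct_sup_sup
    (finrank_span_singleton hy0) (finrank_span_singleton hz0) hcd hyc hzd

theorem Rich.sup_span_pair [Finite V] {E : Set V} (h0 : (0 : V) ∉ E) {a b : V} (ha : a ∈ E)
    (hb : b ∈ E) (hab : a ≠ b) : Rich E (⊥ ⊔ span (ZMod 2) {a} ⊔ span (ZMod 2) {b}) 0 := by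
  have ha0 : a ≠ 0 := fun h => h0 (h ▸ ha)
  have hb0 : b ≠ 0 := fun h => h0 (h ▸ hb)
  have hsub : {a, b} ⊆ E ∩ (⊥ ⊔ span (ZMod 2) {a} ⊔ span (ZMod 2) {b} : Submodule (ZMod 2) V) := by
    rw [Set.pair_subset_iff]
    exact ⟨⟨ha, mem_sup_left (mem_sup_right (mem_span_singleton_self a))⟩,
      ⟨hb, mem_sup_right (mem_span_singleton_self b)⟩⟩
  refine ⟨?_, ?_, ?_, fun c _ hne => ?_⟩
  · rw [finrank_sup_span_singleton, finrank_sup_span_singleton, finrank_bot]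
    · simpa using ha0
    · rw [bot_sup_eq, mem_span_singleton_two]
      exact not_or.2 ⟨hb0, hab.symm⟩
  · refine le_antisymm (span_le.2 Set.inter_subset_right) ?_
    refine sup_le (sup_le bot_le ?_) ?_
    · exact span_mono (Set.singleton_subset_iff.2 (hsub (Set.mem_insert _ _)))
    · exact span_mono (Set.singleton_subset_iff.2 (hsub (Set.mem_insert_of_mem _ rfl)))
  · exact (Set.ncard_pair hab).ge.trans (Set.ncard_le_ncard hsub)
  · exact (Set.ncard_pos (Set.toFinite _)).2 hne

theorem Rich.exists_succ [Finite V] {E : Set V} (hE : Admissible E) {W : Submodule (ZMod 2) V}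
    {j : ℕ} (hW : Rich E W j) (hS : 2 ≤ j → (E ∩ W).ncard = 2 ^ (j + 1) → Struct E W j) {c d : V}
    (hcd : IndPair E W c d) :
    ∃ W' : Submodule (ZMod 2) V, Rich E W' (j + 1) ∧
      (2 ≤ j + 1 → (E ∩ W').ncard = 2 ^ (j + 1 + 1) → Struct E W' (j + 1)) := by
  obtain ⟨c, d, hcd, hclaw⟩ := hW.exists_indPair hE hcd
  refine ⟨_, hW.sup_sup hcd hclaw, fun hj hcard => ?_⟩
  rw [ncard_inter_sup_sup hcd, pow_succ, pow_succ] at hcard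
  have h1 := hW.le_ncard
  have h2 := hW.le_ncard_fib c hcd.left.1 ⟨c, mem_fib_self hcd.left.2⟩
  have h3 := hW.le_ncard_fib d hcd.right.1 ⟨d, mem_fib_self hcd.right.2⟩
  rw [pow_succ] at h1
  obtain rfl | hj' : j = 1 ∨ 2 ≤ j := by omega
  · exact hW.struct_sup_sup hE (by omega) hcd (by omega) (by omega)
  · exact (hS hj' (by rw [pow_succ]; omega)).sup_sup hE hj' hcd (by omega) (by omega)

theorem exists_rich_forall_not_indPair [Finite V] {E : Set V} (hE : Admissible E) {a b : V}
    (ha : a ∈ E) (hb : b ∈ E) (hab : a ≠ b) :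
    ∃ (W : Submodule (ZMod 2) V) (j : ℕ), Rich E W j ∧
      (2 ≤ j → (E ∩ W).ncard = 2 ^ (j + 1) → Struct E W j) ∧ ∀ c d, ¬ IndPair E W c d := by
  by_contra! hcon
  have key : ∀ j, ∃ W : Submodule (ZMod 2) V, Rich E W j ∧
      (2 ≤ j → (E ∩ W).ncard = 2 ^ (j + 1) → Struct E W j) := by
    intro j
    induction j with
    | zero => exact ⟨_, Rich.sup_span_pair hE.zero_notMem ha hb hab, fun h => by omega⟩
    | succ j ih =>
      obtain ⟨W, hW, hS⟩ := ih
      obtain ⟨c, d, hcd⟩ := hcon W j hW hS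
      exact hW.exists_succ hE hS hcd
  obtain ⟨W, hW, -⟩ := key (Module.finrank (ZMod 2) V)
  have h1 := hW.finrank_eq
  have h2 := W.finrank_le
  omega

theorem Admissible.exists_affPair_top [Finite V] {E : Set V} (hE : Admissible E) {r : ℕ}
    (hr : 6 ≤ r) (hV : Module.finrank (ZMod 2) V = r) (hspan : span (ZMod 2) E = ⊤)
    (hcard : E.ncard = 2 ^ (r / 2 - 1) + 2 ^ ((r + 1) / 2 - 1)) :
    ∃ (H₁ H₂ : Submodule (ZMod 2) V) (a₁ a₂ : V), AffPair E ⊤ H₁ a₁ H₂ a₂ ∧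
      Module.finrank (ZMod 2) H₁ = r / 2 - 1 ∧ Module.finrank (ZMod 2) H₂ = (r + 1) / 2 - 1 := by
  obtain ⟨a, ha, b, hb, hab⟩ : ∃ a ∈ E, ∃ b ∈ E, a ≠ b := by
    have h1 : 0 < 2 ^ (r / 2 - 1) := by positivity
    have h2 : 0 < 2 ^ ((r + 1) / 2 - 1) := by positivity
    exact (Set.one_lt_ncard (Set.toFinite E)).1 (by omega)
  obtain ⟨W, j, hW, hS, hno⟩ := exists_rich_forall_not_indPair hE ha hb hab
  have hne : ∀ c, c ∉ W → (fib E W c).Nonempty := fun c =>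
    nonempty_fib_of_forall_not_indPair hspan hno
  obtain ⟨n, hn⟩ : ∃ n, r = 2 * j + 2 + n := Nat.exists_eq_add_of_le
    (hV ▸ hW.finrank_eq ▸ W.finrank_le)
  have hle := hW.le_ncard_of_forall_nonempty hne (hV.trans hn)
  rw [hcard, hn] at hle
  obtain rfl | rfl := eq_zero_or_one_of_card_le hle
  · obtain rfl : W = ⊤ := eq_top_of_finrank_eq (by rw [hW.finrank_eq, hV, hn])
    obtain ⟨H₁, H₂, a₁, a₂, h, h₁, h₂⟩ := hS (by omega) (by
      rw [top_coe, Set.inter_univ, hcard, show r / 2 - 1 = j by omega,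
        show (r + 1) / 2 - 1 = j by omega, pow_succ]
      ring)
    exact ⟨H₁, H₂, a₁, a₂, h, by omega, by omega⟩
  · obtain ⟨c', hc'⟩ : ∃ c, c ∉ W := by
      by_contra! hcon
      obtain rfl : W = ⊤ := eq_top_iff.2 fun x _ => hcon x
      have := hW.finrank_eq
      rw [finrank_top] at this
      omega
    obtain ⟨c, hc, hcc'⟩ := hne c' hc'
    have hcW : c ∉ W := fun h => hc' ((W.add_mem_iff_right h).1 hcc')
    have htop : W ⊔ span (ZMod 2) {c} = ⊤ := eq_top_of_finrank_eq (by
      rw [finrank_sup_span_singleton hcW, hW.finrank_eq, hV, hn])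
    have hunion : E ∩ W ∪ fib E W c = E := by
      ext x
      have hx : x ∈ W ⊔ span (ZMod 2) {c} := htop ▸ mem_top
      rw [mem_sup_span_singleton_iff] at hx
      simp only [Set.mem_union, Set.mem_inter_iff, SetLike.mem_coe, fib, Set.mem_ofPred_eq]
      tauto
    have hdisj : Disjoint (E ∩ W) (fib E W c) := by
      rw [show E ∩ W = fib E W 0 by ext; simp [fib]]
      exact disjoint_fib (by simpa using hcW)
    have hsum := Set.ncard_union_eq hdisj
    rw [hunion, hcard, show r / 2 - 1 = j by omega, show (r + 1) / 2 - 1 = j + 1 by omega] at hsum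
    have h1 := hW.le_ncard
    have h2 := hW.le_ncard_fib c hcW ⟨c, mem_fib_self hc⟩
    obtain ⟨H₁, H₂, a₁, a₂, h, h₁, h₂⟩ := hS (by omega) (by omega)
    rw [← htop]
    rcases h.mem_iff_or_mem_iff hE (by omega) h₁ h₂ hc hcW (by omega) with hfib | hfib
    · exact ⟨_, _, _, _, (h.sup_span_singleton hcW hfib).symm, by omega,
        by rw [h.finrank_sup_span_singleton hcW h₁]; omega⟩
    · exact ⟨_, _, _, _, (h.symm.sup_span_singleton hcW hfib).symm, by omega,
        by rw [h.symm.finrank_sup_span_singleton hcW h₂]; omega⟩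

theorem mem_sdiff_iff_add_mem {H : Submodule (ZMod 2) V} {a : V} (ha : a ∉ H) (x : V) :
    x ∈ ((H ⊔ span (ZMod 2) {a} : Submodule (ZMod 2) V) : Set V) \ (H : Set V) ↔ x + a ∈ H := by
  rw [Set.mem_sdiff, SetLike.mem_coe, SetLike.mem_coe, mem_sup_span_singleton_iff]
  have h : x + a ∈ H → x ∉ H := fun h hx => ha ((H.add_mem_iff_right hx).1 h)
  tauto

end Binary

theorem IFree.not_indFlat {r n : ℕ} {E : Set (V2 r)} (h : IFree n E)
    (U : Submodule (ZMod 2) (V2 r)) : ¬ IndFlat E n U := by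
  classical
  rintro ⟨v, hv, rfl, hE⟩
  have hS : ((Finset.univ.image v : Finset (V2 r)) : Set (V2 r)) = Set.range v := by simp
  refine h ⟨Finset.univ.image v, ?_, ?_, ?_⟩
  · rw [Finset.card_image_of_injective _ hv.injective, Finset.card_univ, Fintype.card_fin]
  · rw [hS]
    exact hv.linearIndepOn_id
  · rw [hS, hE]

theorem stmt1 {r : ℕ} (hr : 6 ≤ r) (E : Set (V2 r)) (h0 : (0 : V2 r) ∉ E)
    (hspan : span (ZMod 2) E = ⊤) (hTF : TriangleFree E) (hI5 : IFree 5 E)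
    (hcard : E.ncard = 2 ^ (r / 2 - 1) + 2 ^ ((r + 1) / 2 - 1)) :
    ∃ V₁ V₂ H₁ H₂ : Submodule (ZMod 2) (V2 r),
      IsCompl V₁ V₂ ∧
      Module.finrank (ZMod 2) V₁ = r / 2 ∧
      Module.finrank (ZMod 2) V₂ = (r + 1) / 2 ∧
      H₁ ≤ V₁ ∧ H₂ ≤ V₂ ∧
      Module.finrank (ZMod 2) H₁ = r / 2 - 1 ∧
      Module.finrank (ZMod 2) H₂ = (r + 1) / 2 - 1 ∧
      E = ((V₁ : Set (V2 r)) \ (H₁ : Set (V2 r))) ∪ ((V₂ : Set (V2 r)) \ (H₂ : Set (V2 r))) := by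
  have hE : Admissible E := ⟨h0, hTF, hI5.not_indFlat⟩
  obtain ⟨H₁, H₂, a₁, a₂, h, h₁, h₂⟩ := hE.exists_affPair_top hr (by simp) hspan hcard
  refine ⟨H₁ ⊔ span (ZMod 2) {a₁}, H₂ ⊔ span (ZMod 2) {a₂}, H₁, H₂,
    ⟨h.disjoint, codisjoint_iff.2 h.sup_eq⟩, ?_, ?_, le_sup_left, le_sup_left, h₁, h₂, ?_⟩
  · rw [finrank_sup_span_singleton h.left, h₁]
    omega
  · rw [finrank_sup_span_singleton h.right, h₂]
    omega
  · ext x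
    have hx := h.mem_iff x
    simp only [mem_top, and_true] at hx
    rw [hx, Set.mem_union, mem_sdiff_iff_add_mem h.left, mem_sdiff_iff_add_mem h.right]
end

section
/- Let r ≥ 2. If E ⊆ F_2^r \ {0} spans, is triangle-free, and is I_4-free, then |E| ≥ 2^(r−2) + 1. -/
open Submodule

section AffineCase

variable {G : Type*} [AddCommGroup G] [Module (ZMod 2) G]

theorem ZMod.eq_zero_or_one_of_two (a : ZMod 2) : a = 0 ∨ a = 1 := by
  revert a; decide

/-- Among the triple sums of any four elements of `E`, at least one lies in `E`. -/
def HasTripleSum (E : Set G) : Prop :=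
  ∀ a ∈ E, ∀ b ∈ E, ∀ c ∈ E, ∀ d ∈ E,
    a + b + c ∈ E ∨ a + b + d ∈ E ∨ a + c + d ∈ E ∨ b + c + d ∈ E

theorem HasTripleSum.compl {E : Set G} (h : HasTripleSum E) : HasTripleSum Eᶜ := by
  intro a ha b hb c hc d hd
  by_contra! hcon
  simp only [Set.mem_compl_iff, not_not] at *
  have ea := ZModModule.add_self a
  have eb := ZModModule.add_self b
  have ec := ZModModule.add_self c
  have ed := ZModModule.add_self d
  have := h _ hcon.1 _ hcon.2.1 _ hcon.2.2.1 _ hcon.2.2.2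
  rw [show a + b + c + (a + b + d) + (a + c + d) = a by grind,
    show a + b + c + (a + b + d) + (b + c + d) = b by grind,
    show a + b + c + (a + c + d) + (b + c + d) = c by grind,
    show a + b + d + (a + c + d) + (b + c + d) = d by grind] at this
  tauto

theorem HasTripleSum.translate {E : Set G} (h : HasTripleSum E) (p : G) :
    HasTripleSum {u | p + u ∈ E} := by
  intro a ha b hb c hc d hd
  have key : ∀ x y z : G, p + x + (p + y) + (p + z) = p + (x + y + z) := fun x y z => by
    have := ZModModule.add_self p
    grind
  have := h _ ha _ hb _ hc _ hd
  simp only [key] at this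
  exact this

/-- Some affine hyperplane is contained in `E` or disjoint from `E`. -/
def HasMonochromaticHyperplane (E : Set G) : Prop :=
  ∃ μ : G →ₗ[ZMod 2] ZMod 2, μ ≠ 0 ∧ ∃ c, (∀ u, μ u = c → u ∈ E) ∨ (∀ u, μ u = c → u ∉ E)

theorem HasMonochromaticHyperplane.of_compl {E : Set G}
    (h : HasMonochromaticHyperplane Eᶜ) : HasMonochromaticHyperplane E := by
  obtain ⟨μ, hμ, c, h⟩ := h
  refine ⟨μ, hμ, c, ?_⟩
  simpa [or_comm] using h

theorem HasMonochromaticHyperplane.of_translate {E : Set G} (p : G)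
    (h : HasMonochromaticHyperplane {u | p + u ∈ E}) : HasMonochromaticHyperplane E := by
  obtain ⟨μ, hμ, c, h⟩ := h
  have key : ∀ u, μ u = μ p + c → μ (p + u) = c := fun u hu => by
    rw [map_add, hu, ← add_assoc, ZModModule.add_self, zero_add]
  have cancel : ∀ u, p + (p + u) = u := fun u => by
    rw [← add_assoc, ZModModule.add_self, zero_add]
  refine ⟨μ, hμ, μ p + c, h.imp (fun h u hu => ?_) (fun h u hu => ?_)⟩
  · simpa [cancel] using h _ (key u hu)
  · simpa [cancel] using h _ (key u hu)

/-- The periods of a set. -/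
def periods (X : Set G) : Submodule (ZMod 2) G :=
  AddSubgroup.toZModSubmodule 2
    { carrier := {h | ∀ x ∈ X, x + h ∈ X}
      add_mem' := fun {a b} ha hb x hx => by
        rw [← add_assoc]; exact hb _ (ha _ hx)
      zero_mem' := fun x hx => by simpa using hx
      neg_mem' := fun {a} ha x hx => by
        rw [ZModModule.neg_eq_self]; exact ha x hx }

theorem mem_periods {X : Set G} {h : G} : h ∈ periods X ↔ ∀ x ∈ X, x + h ∈ X := Iff.rfl

theorem eq_top_of_periods_eq_top {X : Set G} (hX : X.Nonempty) (h : ∀ g, g ∈ periods X) :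
    X = Set.univ := by
  obtain ⟨x, hx⟩ := hX
  ext y
  have := h (x + y) x hx
  simpa [← add_assoc, ZModModule.add_self] using this

/-- Differences of elements outside `T` lie in `S`. -/
def ComplDiffIn (T : Set G) (S : Submodule (ZMod 2) G) : Prop :=
  ∀ t ∉ T, ∀ t' ∉ T, t + t' ∈ S

theorem ComplDiffIn.trans {X Y : Set G} {S : Submodule (ZMod 2) G}
    (hXY : ComplDiffIn X (periods Y)) (hYS : ComplDiffIn Y S) (hY : Y ≠ Set.univ) :
    ComplDiffIn X S := by
  intro x hx x' hx'
  obtain ⟨y, hy⟩ := (Set.ne_univ_iff_exists_notMem Y).1 hY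
  have hp := hXY x hx x' hx'
  have h1 : y + (x + x') ∉ Y := fun h => hy <| by
    have := hp _ h
    rwa [add_assoc, ZModModule.add_self, add_zero] at this
  have := hYS y hy _ h1
  rwa [← add_assoc, ZModModule.add_self, zero_add] at this

theorem complDiffIn_periods_or {X Y T : Set G}
    (h : ∀ x ∈ X, ∀ y ∈ Y, ∀ t ∉ T, ∀ t' ∉ T, x + (t + t') ∈ X ∨ y + (t + t') ∈ Y) :
    ComplDiffIn T (periods X) ∨ ComplDiffIn T (periods Y) := by
  have h' : ∀ t ∉ T, ∀ t' ∉ T, t + t' ∈ periods X ∨ t + t' ∈ periods Y := by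
    intro t ht t' ht'
    by_contra! hcon
    simp only [mem_periods, not_forall] at hcon
    obtain ⟨⟨x, hx, hx'⟩, y, hy, hy'⟩ := hcon
    exact (h x hx y hy t ht t' ht').elim hx' hy'
  by_contra! hcon
  simp only [ComplDiffIn, not_forall] at hcon
  obtain ⟨⟨t₁, h₁, t₂, h₂, hX⟩, t₃, h₃, t₄, h₄, hY⟩ := hcon
  have hY₁₂ := (h' t₁ h₁ t₂ h₂).resolve_left hX
  have aux : ∀ t ∉ T, t₁ + t ∈ periods Y := by
    intro t ht
    by_contra hn
    have hX₁ := (h' t₁ h₁ t ht).resolve_right hn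
    have e : t₁ + t₂ = (t₁ + t) + (t₂ + t) := by
      have := ZModModule.add_self t
      grind
    have e' : t₁ + t = (t₁ + t₂) + (t₂ + t) := by
      have := ZModModule.add_self t₂
      grind
    rcases h' t₂ h₂ t ht with h2 | h2
    · exact hX (e ▸ add_mem hX₁ h2)
    · exact hn (e' ▸ add_mem hY₁₂ h2)
  have e : t₃ + t₄ = (t₁ + t₃) + (t₁ + t₄) := by
    have := ZModModule.add_self t₁
    grind
  exact hY (e ▸ add_mem (aux _ h₃) (aux _ h₄))

theorem ComplDiffIn.exists_fiber_subset {T : Set G} {S : Submodule (ZMod 2) G}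
    (h : ComplDiffIn T S) (hT : T ≠ Set.univ) {l : G →ₗ[ZMod 2] ZMod 2}
    (hl : S ≤ LinearMap.ker l) : ∃ c, ∀ t, l t = c → t ∈ T := by
  obtain ⟨t₀, ht₀⟩ := (Set.ne_univ_iff_exists_notMem T).1 hT
  refine ⟨l t₀ + 1, fun t ht => ?_⟩
  by_contra htT
  have := hl (h t₀ ht₀ t htT)
  rw [LinearMap.mem_ker, map_add, ht, ← add_assoc, ZModModule.add_self] at this
  exact absurd this (by decide)

theorem exists_common_functional {X Y T : Set G} (hX : X ≠ Set.univ) (hY : Y ≠ Set.univ)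
    (hT : T ≠ Set.univ) (hX0 : X.Nonempty)
    (hTX : ComplDiffIn T (periods X))
    (hXYT : ComplDiffIn X (periods Y) ∨ ComplDiffIn X (periods T))
    (hYXT : ComplDiffIn Y (periods X) ∨ ComplDiffIn Y (periods T)) :
    ∃ l : G →ₗ[ZMod 2] ZMod 2, l ≠ 0 ∧ (∃ c, ∀ t, l t = c → t ∈ X) ∧
      (∃ c, ∀ t, l t = c → t ∈ Y) ∧ (∃ c, ∀ t, l t = c → t ∈ T) := by
  have hYX : ComplDiffIn Y (periods X) := hYXT.elim id fun h => h.trans hTX hT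
  have hXX : ComplDiffIn X (periods X) :=
    hXYT.elim (fun h => h.trans hYX hY) fun h => h.trans hTX hT
  obtain ⟨f, hf⟩ : ∃ f, f ∉ periods X := by
    by_contra! h
    exact hX (eq_top_of_periods_eq_top hX0 h)
  obtain ⟨l, hlf, hl⟩ := Submodule.exists_le_ker_of_notMem hf
  exact ⟨l, fun h => hlf (by simp [h]), hXX.exists_fiber_subset hX hl,
    hYX.exists_fiber_subset hY hl, hTX.exists_fiber_subset hT hl⟩

theorem nonempty_of_complDiffIn {X Y T : Set G} (hX : X ≠ Set.univ) (hY : Y ≠ Set.univ)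
    (hX0 : X.Nonempty) (hY0 : Y.Nonempty)
    (hT : ComplDiffIn T (periods X) ∨ ComplDiffIn T (periods Y)) : T.Nonempty := by
  by_contra hE
  rw [Set.not_nonempty_iff_eq_empty] at hE
  subst hE
  have key : ∀ Z : Set G, ComplDiffIn ∅ (periods Z) → Z.Nonempty → Z = Set.univ :=
    fun Z h h0 => eq_top_of_periods_eq_top h0 fun g => by
      simpa using h g (by simp) 0 (by simp)
  exact hT.elim (fun h => hX (key X h hX0)) fun h => hY (key Y h hY0)

theorem hasMonochromaticHyperplane_of_codim_two {E : Set G} (hE : HasTripleSum E)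
    {ψ₁ ψ₂ : G →ₗ[ZMod 2] ZMod 2} {z w : G} (hz₁ : ψ₁ z = 1) (hz₂ : ψ₂ z = 0)
    (hw₁ : ψ₁ w = 0) (hw₂ : ψ₂ w = 1) (hF : ∀ u, ψ₁ u = 0 → ψ₂ u = 0 → u ∈ E) :
    HasMonochromaticHyperplane E := by
  let F := LinearMap.ker ψ₁ ⊓ LinearMap.ker ψ₂
  have hF₁ : ∀ x : F, ψ₁ x = 0 := fun x => x.2.1
  have hF₂ : ∀ x : F, ψ₂ x = 0 := fun x => x.2.2
  have hFE : ∀ x : F, (x : G) ∈ E := fun x => hF x (hF₁ x) (hF₂ x)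
  have coset : ∀ v u : G, ψ₁ u = ψ₁ v → ψ₂ u = ψ₂ v → ∃ x : F, u = v + x := by
    intro v u h₁ h₂
    refine ⟨⟨v + u, ?_, ?_⟩, ?_⟩
    · simp [h₁, ZModModule.add_self]
    · simp [h₂, ZModModule.add_self]
    · simp [← add_assoc, ZModModule.add_self]
  have hψ₁ : ψ₁ ≠ 0 := fun h => by simp [h] at hz₁
  have hψ₂ : ψ₂ ≠ 0 := fun h => by simp [h] at hw₂
  have hψ₁₂ : ψ₁ + ψ₂ ≠ 0 := fun h => by
    have := LinearMap.congr_fun h z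
    simp [hz₁, hz₂] at this
  let slice : G → Set F := fun v => {x | v + (x : G) ∈ E}
  have mem_slice : ∀ v u : G, ψ₁ u = ψ₁ v → ψ₂ u = ψ₂ v → slice v = Set.univ → u ∈ E := by
    intro v u h₁ h₂ h
    obtain ⟨x, rfl⟩ := coset v u h₁ h₂
    exact (h ▸ Set.mem_univ x : x ∈ slice v)
  have notMem_slice : ∀ v u : G, ψ₁ u = ψ₁ v → ψ₂ u = ψ₂ v → ¬ (slice v).Nonempty → u ∉ E := by
    intro v u h₁ h₂ h hu
    obtain ⟨x, rfl⟩ := coset v u h₁ h₂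
    exact h ⟨x, hu⟩
  have hs₁ : ψ₁ (z + w) = 1 := by simp [hz₁, hw₁]
  have hs₂ : ψ₂ (z + w) = 1 := by simp [hz₂, hw₂]
  by_cases hX : slice z = Set.univ
  · refine ⟨ψ₂, hψ₂, 0, Or.inl fun u hu => ?_⟩
    rcases ZMod.eq_zero_or_one_of_two (ψ₁ u) with h | h
    · exact hF u h hu
    · exact mem_slice z u (h.trans hz₁.symm) (hu.trans hz₂.symm) hX
  by_cases hY : slice w = Set.univ
  · refine ⟨ψ₁, hψ₁, 0, Or.inl fun u hu => ?_⟩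
    rcases ZMod.eq_zero_or_one_of_two (ψ₂ u) with h | h
    · exact hF u hu h
    · exact mem_slice w u (hu.trans hw₁.symm) (h.trans hw₂.symm) hY
  by_cases hT : slice (z + w) = Set.univ
  · refine ⟨ψ₁ + ψ₂, hψ₁₂, 0, Or.inl fun u hu => ?_⟩
    rw [LinearMap.add_apply] at hu
    rcases ZMod.eq_zero_or_one_of_two (ψ₁ u) with h | h <;>
    rcases ZMod.eq_zero_or_one_of_two (ψ₂ u) with h' | h' <;> simp only [h, h'] at hu
    · exact hF u h h'
    · exact absurd hu (by decide)
    · exact absurd hu (by decide)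
    · exact mem_slice _ u (h.trans hs₁.symm) (h'.trans hs₂.symm) hT
  have dT : ComplDiffIn (slice (z + w)) (periods (slice z)) ∨
      ComplDiffIn (slice (z + w)) (periods (slice w)) := by
    refine complDiffIn_periods_or fun x hx y hy t ht t' ht' => ?_
    have := hE _ hx _ hy _ (hFE (x + y + t)) _ (hFE (x + y + t'))
    have ex := ZModModule.add_self (x : G)
    have ey := ZModModule.add_self (y : G)
    simp only [slice, Set.mem_ofPred_eq, Submodule.coe_add] at *
    rw [show z + x + (w + y) + (x + y + t) = z + w + (t : G) by grind,
      show z + x + (w + y) + (x + y + t') = z + w + (t' : G) by grind,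
      show z + x + (x + y + t) + (x + y + t') = z + (x + (t + t')) by grind,
      show w + y + (x + y + t) + (x + y + t') = w + (y + (t + t')) by grind] at this
    tauto
  have dX : ComplDiffIn (slice z) (periods (slice w)) ∨
      ComplDiffIn (slice z) (periods (slice (z + w))) := by
    refine complDiffIn_periods_or fun x hx y hy t ht t' ht' => ?_
    have := hE _ hx _ hy _ (hFE (x + y + t)) _ (hFE (x + y + t'))
    have ex := ZModModule.add_self (x : G)
    have ey := ZModModule.add_self (y : G)
    have ew := ZModModule.add_self w
    simp only [slice, Set.mem_ofPred_eq, Submodule.coe_add] at *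
    rw [show w + x + (z + w + y) + (x + y + t) = z + (t : G) by grind,
      show w + x + (z + w + y) + (x + y + t') = z + (t' : G) by grind,
      show w + x + (x + y + t) + (x + y + t') = w + (x + (t + t')) by grind,
      show z + w + y + (x + y + t) + (x + y + t') = z + w + (y + (t + t')) by grind] at this
    tauto
  have dY : ComplDiffIn (slice w) (periods (slice z)) ∨
      ComplDiffIn (slice w) (periods (slice (z + w))) := by
    refine complDiffIn_periods_or fun x hx y hy t ht t' ht' => ?_
    have := hE _ hx _ hy _ (hFE (x + y + t)) _ (hFE (x + y + t'))
    have ex := ZModModule.add_self (x : G)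
    have ey := ZModModule.add_self (y : G)
    have ez := ZModModule.add_self z
    simp only [slice, Set.mem_ofPred_eq, Submodule.coe_add] at *
    rw [show z + x + (z + w + y) + (x + y + t) = w + (t : G) by grind,
      show z + x + (z + w + y) + (x + y + t') = w + (t' : G) by grind,
      show z + x + (x + y + t) + (x + y + t') = z + (x + (t + t')) by grind,
      show z + w + y + (x + y + t) + (x + y + t') = z + w + (y + (t + t')) by grind] at this
    tauto
  by_cases hX0 : (slice z).Nonempty <;> by_cases hY0 : (slice w).Nonempty
  · have hT0 := nonempty_of_complDiffIn hX hY hX0 hY0 dT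
    have key : ∃ l : F →ₗ[ZMod 2] ZMod 2, l ≠ 0 ∧ (∃ c, ∀ t, l t = c → t ∈ slice z) ∧
        (∃ c, ∀ t, l t = c → t ∈ slice w) ∧ (∃ c, ∀ t, l t = c → t ∈ slice (z + w)) := by
      rcases dT with d | d
      · exact exists_common_functional hX hY hT hX0 d dX dY
      · obtain ⟨l, h0, h1, h2, h3⟩ := exists_common_functional hY hX hT hY0 d dY dX
        exact ⟨l, h0, h2, h1, h3⟩
    obtain ⟨l, hl, ⟨α, hα⟩, ⟨β, hβ⟩, ⟨γ, hγ⟩⟩ := key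
    obtain ⟨L, hL⟩ := l.exists_extend
    have hLx : ∀ x : F, L x = l x := fun x => LinearMap.congr_fun hL x
    have lift : ∀ v c, (∀ t, l t = c → t ∈ slice v) →
        ∀ u, ψ₁ u = ψ₁ v → ψ₂ u = ψ₂ v → L u = c + L v → u ∈ E := by
      intro v c h u h₁ h₂ hu
      obtain ⟨x, rfl⟩ := coset v u h₁ h₂
      refine h x ?_
      rw [map_add, hLx] at hu
      grind
    obtain ⟨a, ha⟩ : ∃ a, a = α + L z := ⟨_, rfl⟩
    obtain ⟨b, hb⟩ : ∃ b, b = β + L w := ⟨_, rfl⟩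
    obtain ⟨c, hc⟩ : ∃ c, c = γ + L (z + w) := ⟨_, rfl⟩
    have solve : ∀ a b c x : ZMod 2, (x + (b + c) = a + b + c → x = a) ∧
        (x + (a + c) = a + b + c → x = b) ∧
        (x + (b + c) + (a + c) = a + b + c → x = c) := by decide
    refine ⟨L + (b + c) • ψ₁ + (a + c) • ψ₂, fun h => hl ?_, a + b + c, Or.inl fun u hu => ?_⟩
    · ext x
      have := LinearMap.congr_fun h x
      simpa [hF₁, hF₂, hLx] using this
    · simp only [LinearMap.add_apply, LinearMap.smul_apply, smul_eq_mul] at hu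
      rcases ZMod.eq_zero_or_one_of_two (ψ₁ u) with h | h <;>
      rcases ZMod.eq_zero_or_one_of_two (ψ₂ u) with h' | h' <;>
      simp only [h, h', mul_zero, mul_one, add_zero] at hu
      · exact hF u h h'
      · exact lift w β hβ u (h.trans hw₁.symm) (h'.trans hw₂.symm)
          (((solve a b c _).2.1 hu).trans hb)
      · exact lift z α hα u (h.trans hz₁.symm) (h'.trans hz₂.symm)
          (((solve a b c _).1 hu).trans ha)
      · exact lift _ γ hγ u (h.trans hs₁.symm) (h'.trans hs₂.symm)
          (((solve a b c _).2.2 hu).trans hc)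
  · have hT0 : ¬ (slice (z + w)).Nonempty := fun hT0 =>
      hY0 (nonempty_of_complDiffIn hX hT hX0 hT0 dY)
    refine ⟨ψ₂, hψ₂, 1, Or.inr fun u hu => ?_⟩
    rcases ZMod.eq_zero_or_one_of_two (ψ₁ u) with h | h
    · exact notMem_slice w u (h.trans hw₁.symm) (hu.trans hw₂.symm) hY0
    · exact notMem_slice _ u (h.trans hs₁.symm) (hu.trans hs₂.symm) hT0
  · have hT0 : ¬ (slice (z + w)).Nonempty := fun hT0 =>
      hX0 (nonempty_of_complDiffIn hY hT hY0 hT0 dX)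
    refine ⟨ψ₁, hψ₁, 1, Or.inr fun u hu => ?_⟩
    rcases ZMod.eq_zero_or_one_of_two (ψ₂ u) with h | h
    · exact notMem_slice z u (hu.trans hz₁.symm) (h.trans hz₂.symm) hX0
    · exact notMem_slice _ u (hu.trans hs₁.symm) (h.trans hs₂.symm) hT0
  · refine ⟨ψ₁ + ψ₂, hψ₁₂, 1, Or.inr fun u hu => ?_⟩
    rw [LinearMap.add_apply] at hu
    rcases ZMod.eq_zero_or_one_of_two (ψ₁ u) with h | h <;>
    rcases ZMod.eq_zero_or_one_of_two (ψ₂ u) with h' | h' <;> simp only [h, h'] at hu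
    · exact absurd hu (by decide)
    · exact notMem_slice w u (h.trans hw₁.symm) (h'.trans hw₂.symm) hY0
    · exact notMem_slice z u (h.trans hz₁.symm) (h'.trans hz₂.symm) hX0
    · exact absurd hu (by decide)

theorem exists_apply_eq_one {f : G →ₗ[ZMod 2] ZMod 2} (hf : f ≠ 0) : ∃ x, f x = 1 := by
  by_contra! h
  exact hf (LinearMap.ext fun x => (ZMod.eq_zero_or_one_of_two (f x)).resolve_right (h x))

theorem exists_functional_ne_zero [Nontrivial G] : ∃ f : G →ₗ[ZMod 2] ZMod 2, f ≠ 0 := by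
  obtain ⟨x, hx⟩ := exists_ne (0 : G)
  obtain ⟨f, hf, -⟩ := Submodule.exists_le_ker_of_notMem
    (show x ∉ (⊥ : Submodule (ZMod 2) G) by simpa using hx)
  exact ⟨f, fun h => hf (by simp [h])⟩

end AffineCase

theorem HasTripleSum.hasMonochromaticHyperplane {G : Type*} [AddCommGroup G] [Module (ZMod 2) G]
    [FiniteDimensional (ZMod 2) G] [Nontrivial G] {E : Set G} (hE : HasTripleSum E) :
    HasMonochromaticHyperplane E := by
  induction hn : Module.finrank (ZMod 2) G using Nat.strong_induction_on generalizing G with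
  | _ n ih =>
  obtain ⟨ψ₁, hψ₁⟩ := exists_functional_ne_zero (G := G)
  have hdim := Module.Dual.finrank_ker_add_one_of_ne_zero hψ₁
  rcases subsingleton_or_nontrivial (LinearMap.ker ψ₁) with hK | hK
  · refine ⟨ψ₁, hψ₁, 0, ?_⟩
    have : ∀ u, ψ₁ u = 0 → u = 0 := fun u hu =>
      congrArg Subtype.val (Subsingleton.elim (⟨u, hu⟩ : LinearMap.ker ψ₁) 0)
    by_cases h : (0 : G) ∈ E
    · exact Or.inl fun u hu => this u hu ▸ h
    · exact Or.inr fun u hu => this u hu ▸ h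
  have hEK : HasTripleSum {x : LinearMap.ker ψ₁ | (x : G) ∈ E} := by
    intro a ha b hb c hc d hd
    simpa using hE _ ha _ hb _ hc _ hd
  obtain ⟨μ, hμ, c, hc⟩ := ih _ (by omega) hEK rfl
  obtain ⟨ψ₂, hψ₂⟩ := μ.exists_extend
  have hψμ : ∀ x : LinearMap.ker ψ₁, ψ₂ x = μ x := fun x => LinearMap.congr_fun hψ₂ x
  obtain ⟨w, hw⟩ := exists_apply_eq_one hμ
  obtain ⟨z, hz₁, hz₂⟩ : ∃ z, ψ₁ z = 1 ∧ ψ₂ z = 0 := by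
    obtain ⟨z, hz⟩ := exists_apply_eq_one hψ₁
    rcases ZMod.eq_zero_or_one_of_two (ψ₂ z) with h | h
    · exact ⟨z, hz, h⟩
    · refine ⟨z + w, by simp [hz], ?_⟩
      rw [map_add, hψμ, hw, h]
      rfl
  have hw₁ : ψ₁ w = 0 := w.2
  have hw₂ : ψ₂ w = 1 := (hψμ w).trans hw
  apply HasMonochromaticHyperplane.of_translate (c • (w : G))
  rcases hc with hc | hc
  · refine hasMonochromaticHyperplane_of_codim_two (hE.translate _) hz₁ hz₂ hw₁ hw₂ ?_
    intro u h₁ h₂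
    refine hc ⟨c • (w : G) + u, by simp [h₁]⟩ ?_
    rw [← hψμ]
    simp [h₂, hw₂]
  · apply HasMonochromaticHyperplane.of_compl
    refine hasMonochromaticHyperplane_of_codim_two (hE.translate _).compl hz₁ hz₂ hw₁ hw₂ ?_
    intro u h₁ h₂
    refine hc ⟨c • (w : G) + u, by simp [h₁]⟩ ?_
    rw [← hψμ]
    simp [h₂, hw₂]

section Pentagon

variable {r : ℕ} {E : Set (V2 r)}

theorem exists_sum_mem (h0 : (0 : V2 r) ∉ E) (hTF : TriangleFree E) (hI4 : IFree 4 E)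
    {a b c d : V2 r} (ha : a ∈ E) (hb : b ∈ E) (hc : c ∈ E) (hd : d ∈ E) :
    a + b + c ∈ E ∨ a + b + d ∈ E ∨ a + c + d ∈ E ∨ b + c + d ∈ E ∨ a + b + c + d ∈ E := by
  by_contra! hcon
  obtain ⟨n1, n2, n3, n4, n5⟩ := hcon
  let v : Fin 4 → V2 r := ![a, b, c, d]
  have hv : ∀ i, v i ∈ E := by
    intro i; fin_cases i <;> assumption
  have hnot : ∀ g : Fin 4 → ZMod 2, ∑ i, g i • v i ∈ E → ∃ i, g = Pi.single i 1 := by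
    intro g hg
    have m1 := hTF a ha b hb
    have m2 := hTF a ha c hc
    have m3 := hTF a ha d hd
    have m4 := hTF b hb c hc
    have m5 := hTF b hb d hd
    have m6 := hTF c hc d hd
    simp only [Fin.sum_univ_four, v, Matrix.cons_val] at hg
    have hsingle : ∀ x₀ x₁ x₂ x₃ : ZMod 2, x₀.val + x₁.val + x₂.val + x₃.val = 1 →
        ∃ i, ![x₀, x₁, x₂, x₃] = Pi.single i 1 := by decide
    have hg' : g = ![g 0, g 1, g 2, g 3] := by
      ext i; fin_cases i <;> rfl
    rw [hg']
    apply hsingle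
    rcases ZMod.eq_zero_or_one_of_two (g 0) with h₀ | h₀ <;>
    rcases ZMod.eq_zero_or_one_of_two (g 1) with h₁ | h₁ <;>
    rcases ZMod.eq_zero_or_one_of_two (g 2) with h₂ | h₂ <;>
    rcases ZMod.eq_zero_or_one_of_two (g 3) with h₃ | h₃ <;>
    simp only [h₀, h₁, h₂, h₃, zero_smul, one_smul, zero_add, add_zero] at hg ⊢ <;>
    first | rfl | contradiction
  have hsum_single : ∀ i, ∑ j, (Pi.single i 1 : Fin 4 → ZMod 2) j • v j = v i := by
    intro i
    simp [Pi.single_apply]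
  have hli : LinearIndependent (ZMod 2) v := by
    rw [Fintype.linearIndependent_iff]
    intro g hg
    have hshift : ∀ i, ∃ j, g + Pi.single i 1 = Pi.single j 1 := by
      intro i
      apply hnot
      simp only [Pi.add_apply, add_smul, Finset.sum_add_distrib, hg, hsum_single, zero_add]
      exact hv i
    have : ∀ g : Fin 4 → ZMod 2, (∀ i, ∃ j, g + Pi.single i 1 = Pi.single j 1) → ∀ i, g i = 0 := by
      decide
    exact this g hshift
  refine hI4 ⟨Finset.univ.image v, ?_, ?_, ?_⟩
  · rw [Finset.card_image_of_injective _ hli.injective]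
    rfl
  · rw [Finset.coe_image, Finset.coe_univ, Set.image_univ]
    exact hli.linearIndepOn_id
  · simp only [Finset.coe_image, Finset.coe_univ, Set.image_univ]
    ext x
    constructor
    · rintro ⟨hx, hxs⟩
      obtain ⟨g, rfl⟩ := (Submodule.mem_span_range_iff_exists_fun _).1 hxs
      obtain ⟨i, rfl⟩ := hnot g hx
      exact ⟨i, (hsum_single i).symm⟩
    · rintro ⟨i, rfl⟩
      exact ⟨hv i, subset_span ⟨i, rfl⟩⟩

theorem exists_dual_eq_one_of_hasTripleSum (hne : E.Nonempty) (hTF : TriangleFree E)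
    (hE : HasTripleSum E) : ∃ φ : V2 r →ₗ[ZMod 2] ZMod 2, ∀ e ∈ E, φ e = 1 := by
  obtain ⟨p, hp⟩ := hne
  let T : Set (V2 r) := {v | ∃ a ∈ E, ∃ b ∈ E, ∃ c ∈ E, v = a + b + c}
  have hT0 : (0 : V2 r) ∉ T := by
    rintro ⟨a, ha, b, hb, c, hc, h⟩
    refine hTF a ha b hb ?_
    have := ZModModule.add_self c
    rwa [show a + b = c by grind]
  have hTadd : ∀ t ∈ T, ∀ d ∈ E, ∀ e ∈ E, t + (d + e) ∈ T := by
    rintro _ ⟨a, ha, b, hb, c, hc, rfl⟩ d hd e he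
    rcases hE a ha b hb c hc d hd with h | h | h | h
    · exact ⟨_, h, d, hd, e, he, by grind⟩
    · exact ⟨_, h, c, hc, e, he, by grind⟩
    · exact ⟨_, h, b, hb, e, he, by grind⟩
    · exact ⟨_, h, a, ha, e, he, by grind⟩
  let D : Submodule (ZMod 2) (V2 r) := span (ZMod 2) {v | ∃ d ∈ E, ∃ e ∈ E, v = d + e}
  have hD : D ≤ periods T := by
    refine span_le.2 ?_
    rintro _ ⟨d, hd, e, he, rfl⟩
    exact fun t ht => hTadd t ht d hd e he
  have hpT : p ∈ T := ⟨p, hp, p, hp, p, hp, by rw [ZModModule.add_self, zero_add]⟩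
  have hpD : p ∉ D := fun h => hT0 <| by
    simpa [ZModModule.add_self] using hD h p hpT
  obtain ⟨φ, hφp, hφ⟩ := Submodule.exists_le_ker_of_notMem hpD
  refine ⟨φ, fun e he => ?_⟩
  have h1 := (ZMod.eq_zero_or_one_of_two _).resolve_left hφp
  have h2 : φ (p + e) = 0 := hφ (subset_span ⟨p, hp, e, he, rfl⟩)
  rw [map_add, h1] at h2
  rcases ZMod.eq_zero_or_one_of_two (φ e) with h | h
  · simp [h] at h2
  · exact h

/-- Five elements of `E` summing to zero. -/
structure IsPentagon (E : Set (V2 r)) (a : Fin 5 → V2 r) : Prop where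
  mem : ∀ i, a i ∈ E
  sum_eq_zero : ∑ i, a i = 0

namespace IsPentagon

variable {a : Fin 5 → V2 r}

theorem sum_of_nodup (ha : IsPentagon E a) {i j k l m : Fin 5} (h : [i, j, k, l, m].Nodup) :
    a i + a j + a k + a l + a m = 0 := by
  have hu : [i, j, k, l, m].toFinset = Finset.univ :=
    Finset.eq_univ_of_card _ (by rw [List.toFinset_card_of_nodup h]; rfl)
  have := ha.sum_eq_zero
  rw [← hu, List.sum_toFinset _ h] at this
  simpa [add_assoc] using this

theorem triple_eq (ha : IsPentagon E a) {i j k l m : Fin 5} (h : [i, j, k, l, m].Nodup) :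
    a i + a j + a k = a l + a m := by
  have := ha.sum_of_nodup h
  have := ZModModule.add_self (a l)
  have := ZModModule.add_self (a m)
  grind

theorem exists_nodup_of_ne : ∀ i j : Fin 5, i ≠ j → ∃ k l m, [k, l, m, i, j].Nodup := by
  decide

theorem exists_nodup_of_nodup :
    ∀ i j k l : Fin 5, [i, j, k, l].Nodup → ∃ m, [i, j, k, l, m].Nodup := by
  decide

theorem injective (ha : IsPentagon E a) (hTF : TriangleFree E) : Function.Injective a := by
  intro i j hij
  by_contra hne
  obtain ⟨k, l, m, h⟩ := exists_nodup_of_ne i j hne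
  have h3 := ha.triple_eq h
  refine hTF _ (ha.mem k) _ (ha.mem l) ?_
  have hm := ha.mem m
  rw [hij, ZModModule.add_self] at h3
  have := ZModModule.add_self (a m)
  rwa [show a k + a l = a m by grind]

theorem not_opposite (ha : IsPentagon E a) (hTF : TriangleFree E) {z : V2 r} {i j k l : Fin 5}
    (h : [i, j, k, l].Nodup) (hij : z + (a i + a j) ∈ E) : z + (a k + a l) ∉ E := by
  intro hkl
  obtain ⟨m, hm⟩ := exists_nodup_of_nodup i j k l h
  have hs := ha.sum_of_nodup hm
  refine hTF _ hij _ hkl ?_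
  have := ZModModule.add_self z
  have := ZModModule.add_self (a m)
  rw [show z + (a i + a j) + (z + (a k + a l)) = a m by grind]
  exact ha.mem m

theorem exists_edge (ha : IsPentagon E a) (h0 : (0 : V2 r) ∉ E) (hTF : TriangleFree E)
    (hI4 : IFree 4 E) {z : V2 r} (hz : z ∈ E) {i j k l m : Fin 5} (h : [i, j, k, l, m].Nodup) :
    z + (a i + a j) ∈ E ∨ z + (a i + a k) ∈ E ∨ z + (a j + a k) ∈ E ∨ z + (a l + a m) ∈ E := by
  have h3 := ha.triple_eq h
  have := exists_sum_mem h0 hTF hI4 (ha.mem i) (ha.mem j) (ha.mem k) hz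
  rw [h3] at this
  simp only [add_comm z]
  exact this.resolve_left (hTF _ (ha.mem l) _ (ha.mem m))

set_option synthInstance.maxSize 1000 in
set_option synthInstance.maxHeartbeats 200000 in
theorem bool_edge_count : ∀ p01 p02 p03 p04 p12 p13 p14 p23 p24 p34 : Bool,
    ¬(p01 ∧ p23) → ¬(p01 ∧ p24) → ¬(p01 ∧ p34) → ¬(p02 ∧ p13) → ¬(p02 ∧ p14) → ¬(p02 ∧ p34) →
    ¬(p03 ∧ p12) → ¬(p03 ∧ p14) → ¬(p03 ∧ p24) → ¬(p04 ∧ p12) → ¬(p04 ∧ p13) → ¬(p04 ∧ p23) →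
    ¬(p12 ∧ p34) → ¬(p13 ∧ p24) → ¬(p14 ∧ p23) →
    (p01 ∨ p02 ∨ p12 ∨ p34) → (p01 ∨ p03 ∨ p13 ∨ p24) → (p01 ∨ p04 ∨ p14 ∨ p23) →
    (p02 ∨ p03 ∨ p23 ∨ p14) → (p02 ∨ p04 ∨ p24 ∨ p13) → (p03 ∨ p04 ∨ p34 ∨ p12) →
    (p12 ∨ p13 ∨ p23 ∨ p04) → (p12 ∨ p14 ∨ p24 ∨ p03) → (p13 ∨ p14 ∨ p34 ∨ p02) →
    (p23 ∨ p24 ∨ p34 ∨ p01) →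
    3 ≤ p01.toNat + p02.toNat + p03.toNat + p04.toNat + p12.toNat + p13.toNat + p14.toNat +
      p23.toNat + p24.toNat + p34.toNat ∧
    p01.toNat + p02.toNat + p03.toNat + p04.toNat + p12.toNat + p13.toNat + p14.toNat +
      p23.toNat + p24.toNat + p34.toNat ≤ 4 := by
  decide +kernel

/-- The pairs `i < j`. -/
def pairs : Finset (Fin 5 × Fin 5) := Finset.univ.filter fun e => e.1 < e.2

open Classical in
/-- The pairs `i < j` for which the translate of `z` by `a i + a j` lies in `E`. -/
noncomputable def edges (E : Set (V2 r)) (a : Fin 5 → V2 r) (z : V2 r) :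
    Finset (Fin 5 × Fin 5) :=
  pairs.filter fun e => z + (a e.1 + a e.2) ∈ E

theorem pairs_eq : pairs =
    {(0, 1), (0, 2), (0, 3), (0, 4), (1, 2), (1, 3), (1, 4), (2, 3), (2, 4), (3, 4)} := by
  decide

theorem card_edges (ha : IsPentagon E a) (h0 : (0 : V2 r) ∉ E) (hTF : TriangleFree E)
    (hI4 : IFree 4 E) {z : V2 r} (hz : z ∈ E) :
    3 ≤ (edges E a z).card ∧ (edges E a z).card ≤ 4 := by
  classical
  let p : Fin 5 → Fin 5 → Bool := fun i j => decide (z + (a i + a j) ∈ E)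
  have hcard : (edges E a z).card = (p 0 1).toNat + (p 0 2).toNat + (p 0 3).toNat +
      (p 0 4).toNat + (p 1 2).toNat + (p 1 3).toNat + (p 1 4).toNat + (p 2 3).toNat +
      (p 2 4).toNat + (p 3 4).toNat := by
    rw [edges, Finset.card_filter, pairs_eq]
    have ite_eq : ∀ i j, (if z + (a i + a j) ∈ E then 1 else 0) = (p i j).toNat := by
      intro i j
      by_cases h : z + (a i + a j) ∈ E <;> simp [p, h]
    repeat rw [Finset.sum_insert (by decide)]
    rw [Finset.sum_singleton]
    simp only [ite_eq]
    ring
  have hopp : ∀ i j k l, [i, j, k, l].Nodup → ¬(p i j ∧ p k l) := by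
    intro i j k l h
    simp only [p, decide_eq_true_eq]
    exact fun hp => ha.not_opposite hTF h hp.1 hp.2
  have hedge : ∀ i j k l m, [i, j, k, l, m].Nodup → (p i j ∨ p i k ∨ p j k ∨ p l m) := by
    intro i j k l m h
    simp only [p, decide_eq_true_eq]
    exact ha.exists_edge h0 hTF hI4 hz h
  rw [hcard]
  apply bool_edge_count <;> first
    | exact hopp _ _ _ _ (by decide)
    | exact hedge _ _ _ _ _ (by decide)

theorem pair_sum_ne_zero (ha : IsPentagon E a) (hTF : TriangleFree E) {i j : Fin 5} (h : i ≠ j) :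
    a i + a j ≠ 0 := fun h' => h <| ha.injective hTF <| by
  have := ZModModule.add_self (a j)
  grind

theorem pair_sum_injOn (ha : IsPentagon E a) (h0 : (0 : V2 r) ∉ E) (hTF : TriangleFree E) :
    Set.InjOn (fun e : Fin 5 × Fin 5 => a e.1 + a e.2) pairs := by
  rintro ⟨i, j⟩ hij ⟨k, l⟩ hkl h
  simp only [pairs, Finset.coe_filter, Finset.mem_univ, true_and, Set.mem_ofPred_eq] at hij hkl h
  have hinj := ha.injective hTF
  have share : ∀ {x y z : Fin 5}, a x + a y = a x + a z → y = z := fun h =>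
    hinj (add_left_cancel h)
  by_cases h1 : i = k
  · subst h1
    rw [share h]
  by_cases h2 : j = l
  · subst h2
    rw [add_comm, add_comm (a k)] at h
    rw [share h]
  by_cases h3 : i = l
  · subst h3
    rw [add_comm (a k)] at h
    have := share h
    omega
  by_cases h4 : j = k
  · subst h4
    rw [add_comm] at h
    have := share h
    omega
  obtain ⟨m, hm⟩ := exists_nodup_of_nodup i j k l (by simp; omega)
  have hs := ha.sum_of_nodup hm
  rw [h, add_assoc (a k + a l), ZModModule.add_self, zero_add] at hs
  exact absurd (hs ▸ ha.mem m) h0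

end IsPentagon

open IsPentagon

theorem IsPentagon.card_lt (hr : 2 ≤ r) {a : Fin 5 → V2 r} (ha : IsPentagon E a)
    (h0 : (0 : V2 r) ∉ E) (hspan : span (ZMod 2) E = ⊤) (hTF : TriangleFree E)
    (hI4 : IFree 4 E) : 2 ^ (r - 2) < E.ncard := by
  classical
  let W : Submodule (ZMod 2) (V2 r) := span (ZMod 2) (Set.range fun i : Fin 4 => a i.castSucc)
  have haW : ∀ i, a i ∈ W := by
    have hc : ∀ i : Fin 4, a i.castSucc ∈ W := fun i => subset_span ⟨i, rfl⟩
    intro i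
    refine Fin.lastCases ?_ hc i
    have hs := ha.sum_eq_zero
    rw [Fin.sum_univ_castSucc] at hs
    have := ZModModule.add_self (a (Fin.last 4))
    rw [show a (Fin.last 4) = ∑ i : Fin 4, a i.castSucc by grind]
    exact sum_mem fun i _ => hc i
  have hclosed : ∀ z ∈ E, ∀ w ∈ E, ∃ e ∈ E, z + w + e ∈ W := by
    intro z hz w hw
    by_contra! hcon
    have hcover : pairs ⊆ edges E a z ∪ edges E a w := by
      rintro ⟨i, j⟩ hij
      have main : z + (a i + a j) ∈ E ∨ w + (a i + a j) ∈ E := by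
        have hself := ZModModule.add_self (z + w)
        rcases exists_sum_mem h0 hTF hI4 (ha.mem i) (ha.mem j) hz hw with h | h | h | h | h
        · exact Or.inl (add_comm z _ ▸ h)
        · exact Or.inr (add_comm w _ ▸ h)
        · refine absurd ?_ (hcon _ h)
          rw [show z + w + (a i + z + w) = a i by grind]
          exact haW i
        · refine absurd ?_ (hcon _ h)
          rw [show z + w + (a j + z + w) = a j by grind]
          exact haW j
        · refine absurd ?_ (hcon _ h)
          rw [show z + w + (a i + a j + z + w) = a i + a j by grind]
          exact add_mem (haW i) (haW j)
      simp only [edges, Finset.mem_union, Finset.mem_filter]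
      tauto
    have h1 := Finset.card_le_card hcover
    have h2 := Finset.card_union_le (edges E a z) (edges E a w)
    have h3 := (ha.card_edges h0 hTF hI4 hz).2
    have h4 := (ha.card_edges h0 hTF hI4 hw).2
    have h5 : pairs.card = 10 := by decide
    omega
  have hmeet : ∀ v, ∃ e ∈ E, v + e ∈ W := by
    intro v
    have hv : v ∈ span (ZMod 2) E := hspan ▸ mem_top
    induction hv using span_induction with
    | mem x hx => exact ⟨x, hx, by rw [ZModModule.add_self]; exact W.zero_mem⟩
    | zero => exact ⟨a 0, ha.mem 0, by simpa using haW 0⟩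
    | add x y _ _ hx hy =>
      obtain ⟨z, hz, hxz⟩ := hx
      obtain ⟨w, hw, hyw⟩ := hy
      obtain ⟨e, he, hzwe⟩ := hclosed z hz w hw
      refine ⟨e, he, ?_⟩
      have := ZModModule.add_self z
      have := ZModModule.add_self w
      rw [show x + y + e = x + z + (y + w) + (z + w + e) by grind]
      exact add_mem (add_mem hxz hyw) hzwe
    | smul c x _ hx =>
      rcases ZMod.eq_zero_or_one_of_two c with rfl | rfl
      · exact ⟨a 0, ha.mem 0, by simpa using haW 0⟩
      · simpa using hx
  have hmk : ∀ x y : V2 r, x + y ∈ W → W.mkQ x = W.mkQ y := by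
    intro x y h
    rw [← sub_eq_zero, ← map_sub, ZModModule.sub_eq_add]
    exact (Submodule.Quotient.mk_eq_zero W).2 h
  let S : Finset (V2 r) := E.toFinite.toFinset
  have hS : ∀ x, x ∈ S ↔ x ∈ E := fun x => Set.Finite.mem_toFinset _
  have hfour : ∀ q, 4 ≤ (S.filter fun x => W.mkQ x = q).card := by
    intro q
    obtain ⟨v, rfl⟩ := W.mkQ_surjective q
    obtain ⟨z, hz, hvz⟩ := hmeet v
    rw [hmk v z hvz]
    have hsub : insert z ((edges E a z).image fun e => z + (a e.1 + a e.2)) ⊆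
        S.filter fun x => W.mkQ x = W.mkQ z := by
      intro x hx
      rw [Finset.mem_filter, hS]
      rcases Finset.mem_insert.1 hx with rfl | hx
      · exact ⟨hz, rfl⟩
      obtain ⟨e, he, rfl⟩ := Finset.mem_image.1 hx
      refine ⟨(Finset.mem_filter.1 he).2, hmk _ _ ?_⟩
      have := ZModModule.add_self z
      rw [show z + (a e.1 + a e.2) + z = a e.1 + a e.2 by grind]
      exact add_mem (haW _) (haW _)
    refine le_trans ?_ (Finset.card_le_card hsub)
    rw [Finset.card_insert_of_notMem, Finset.card_image_of_injOn]
    · have := (ha.card_edges h0 hTF hI4 hz).1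
      omega
    · intro e he f hf h
      exact ha.pair_sum_injOn h0 hTF (Finset.mem_filter.1 he).1 (Finset.mem_filter.1 hf).1
        (add_left_cancel h)
    · intro h
      obtain ⟨e, he, h⟩ := Finset.mem_image.1 h
      have hlt := (Finset.mem_filter.1 (Finset.mem_filter.1 he).1).2
      exact ha.pair_sum_ne_zero hTF hlt.ne (by simpa using h)
  have hfive : 4 < (S.filter fun x => W.mkQ x = 0).card := by
    have hsub : Finset.univ.image a ⊆ S.filter fun x => W.mkQ x = 0 := by
      intro x hx
      obtain ⟨i, -, rfl⟩ := Finset.mem_image.1 hx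
      rw [Finset.mem_filter, hS]
      exact ⟨ha.mem i, by simpa using haW i⟩
    refine lt_of_lt_of_le ?_ (Finset.card_le_card hsub)
    rw [Finset.card_image_of_injective _ (ha.injective hTF)]
    decide
  have : Fintype (V2 r ⧸ W) := Fintype.ofFinite _
  have hcount : 4 * Nat.card (V2 r ⧸ W) < S.card := by
    rw [Finset.card_eq_sum_card_fiberwise (f := W.mkQ) (t := Finset.univ)
      fun x _ => Finset.mem_coe.2 (Finset.mem_univ _)]
    calc 4 * Nat.card (V2 r ⧸ W) = ∑ _q : V2 r ⧸ W, 4 := by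
          simp [mul_comm]
      _ < _ := Finset.sum_lt_sum (fun q _ => hfour q) ⟨0, Finset.mem_univ _, hfive⟩
  have hWcard : Nat.card W ≤ 16 := by
    rw [Module.natCard_eq_pow_finrank (K := ZMod 2), Nat.card_zmod]
    exact Nat.pow_le_pow_right (n := 2) (by norm_num)
      (finrank_range_le_card fun i : Fin 4 => a i.castSucc)
  have hV := W.card_eq_card_quotient_mul_card
  have hVcard : Nat.card (V2 r) = 4 * 2 ^ (r - 2) := by
    obtain ⟨s, rfl⟩ := Nat.exists_eq_add_of_le hr
    simp [pow_add]
  have hSE : E.ncard = S.card := Set.ncard_eq_toFinset_card E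
  rw [hSE]
  nlinarith [Nat.zero_le (Nat.card (V2 r ⧸ W))]

end Pentagon

theorem card_lt_of_affine {r : ℕ} (hr : 2 ≤ r) {E : Set (V2 r)} (hE : HasTripleSum E)
    (hspan : span (ZMod 2) E = ⊤) {p : V2 r} (hp : p ∈ E) {φ : V2 r →ₗ[ZMod 2] ZMod 2}
    (hφ : ∀ e ∈ E, φ e = 1) : 2 ^ (r - 2) < E.ncard := by
  have hφ0 : φ ≠ 0 := fun h => by simpa [h] using hφ p hp
  have hdim := Module.Dual.finrank_ker_add_one_of_ne_zero hφ0
  rw [Module.finrank_fin_fun] at hdim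
  have : Nontrivial (LinearMap.ker φ) := Module.nontrivial_of_finrank_pos (R := ZMod 2) (by omega)
  have hshift : ∀ e ∈ E, φ (p + e) = 0 := fun e he => by
    rw [map_add, hφ p hp, hφ e he]; rfl
  have cancel : ∀ e : V2 r, p + (p + e) = e := fun e => by
    rw [← add_assoc, ZModModule.add_self, zero_add]
  have hE' : HasTripleSum {u : LinearMap.ker φ | p + (u : V2 r) ∈ E} := by
    intro a ha b hb c hc d hd
    simpa using hE.translate p _ ha _ hb _ hc _ hd
  obtain ⟨μ, hμ, c, hc⟩ := hE'.hasMonochromaticHyperplane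
  have hnonconst : ∃ u : LinearMap.ker φ, p + (u : V2 r) ∈ E ∧ μ u ≠ 0 := by
    by_contra! hcon
    obtain ⟨m, hm⟩ := μ.exists_extend
    have hmμ : ∀ x : LinearMap.ker φ, m x = μ x := fun x => LinearMap.congr_fun hm x
    have hzero : m + m p • φ = 0 := by
      refine LinearMap.ext_on hspan fun e he => ?_
      have h1 := hcon ⟨p + e, hshift e he⟩ (by simpa [cancel] using he)
      rw [← hmμ, map_add] at h1
      simpa [hφ e he, add_comm] using h1
    refine hμ (LinearMap.ext fun x => ?_)
    have := LinearMap.congr_fun hzero x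
    simpa [hmμ] using this
  obtain ⟨u, hu, hμu⟩ := hnonconst
  have hμu := (ZMod.eq_zero_or_one_of_two _).resolve_left hμu
  rcases hc with hc | hc
  swap
  · rcases ZMod.eq_zero_or_one_of_two c with rfl | rfl
    · exact absurd (by simpa using hp) (hc 0 (map_zero μ))
    · exact absurd hu (hc u hμu)
  have hdim' := Module.Dual.finrank_ker_add_one_of_ne_zero hμ
  have hker : Nat.card (LinearMap.ker μ) = 2 ^ (r - 2) := by
    rw [Module.natCard_eq_pow_finrank (K := ZMod 2), Nat.card_zmod]
    congr 1
    omega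
  obtain ⟨s, hs⟩ : ∃ s, μ s = c := by
    rcases ZMod.eq_zero_or_one_of_two c with rfl | rfl
    · exact ⟨0, map_zero μ⟩
    · exact ⟨u, hμu⟩
  obtain ⟨t, ht, htc⟩ : ∃ t : LinearMap.ker φ, p + (t : V2 r) ∈ E ∧ μ t ≠ c := by
    rcases ZMod.eq_zero_or_one_of_two c with rfl | rfl
    · exact ⟨u, hu, by simp [hμu]⟩
    · exact ⟨0, by simpa using hp, by simp⟩
  let f : LinearMap.ker μ → V2 r := fun x => p + ((s + x : LinearMap.ker φ) : V2 r)
  have hf : Function.Injective f := fun x y h =>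
    Subtype.ext (add_left_cancel (Subtype.ext (add_left_cancel h)))
  have hmem : ∀ x, f x ∈ E := fun x => hc (s + x) (by
    rw [map_add, hs, LinearMap.mem_ker.1 x.2, add_zero])
  have hss : Set.range f ⊂ E := by
    refine ⟨Set.range_subset_iff.2 hmem, fun h => ?_⟩
    obtain ⟨x, hx⟩ := h ht
    have : s + x = t := Subtype.ext (add_left_cancel hx)
    refine htc ?_
    rw [← this, map_add, hs, LinearMap.mem_ker.1 x.2, add_zero]
  have hlt := Set.ncard_lt_ncard hss E.toFinite
  rwa [← Set.image_univ, Set.ncard_image_of_injective _ hf, Set.ncard_univ, hker] at hlt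

theorem stmt14 {r : ℕ} (hr : 2 ≤ r) (E : Set (V2 r)) (h0 : (0 : V2 r) ∉ E)
    (hspan : span (ZMod 2) E = ⊤) (hTF : TriangleFree E) (hI4 : IFree 4 E) :
    2 ^ (r - 2) + 1 ≤ E.ncard := by
  by_cases hpent : ∃ a ∈ E, ∃ b ∈ E, ∃ c ∈ E, ∃ d ∈ E, a + b + c + d ∈ E
  · obtain ⟨a, ha, b, hb, c, hc, d, hd, he⟩ := hpent
    have hP : IsPentagon E ![a, b, c, d, a + b + c + d] := by
      refine ⟨fun i => by fin_cases i <;> assumption, ?_⟩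
      simp [Fin.sum_univ_five, ZModModule.add_self]
    exact hP.card_lt hr h0 hspan hTF hI4
  · push Not at hpent
    have hE : HasTripleSum E := by
      intro a ha b hb c hc d hd
      have := exists_sum_mem h0 hTF hI4 ha hb hc hd
      have := hpent a ha b hb c hc d hd
      tauto
    have hne : E.Nonempty := by
      by_contra h
      rw [Set.not_nonempty_iff_eq_empty] at h
      rw [h, span_empty] at hspan
      have hdim := Module.finrank_fin_fun (ZMod 2) (n := r)
      rw [← finrank_top (ZMod 2) (V2 r), ← hspan, finrank_bot] at hdim
      omega
    obtain ⟨p, hp⟩ := hne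
    obtain ⟨φ, hφ⟩ := exists_dual_eq_one_of_hasTripleSum ⟨p, hp⟩ hTF hE
    exact card_lt_of_affine hr hE hspan hp hφ
end
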